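/- arXiv:0911.2214 — 8 statements merged into one kernel-verified Lean document; each statement's English description precedes it below -/
import Mathlib

section
/- Let S be a set of k ≥ 3 vertices and let u, v ∈ S be two designated distinct vertices. Define the generalized betweenness constraint c on rankings π of S by c(π) = 0 if {π(u), π(v)} = {1, k} and c(π) = 1 otherwise. Then c is weakly fragile. -/
open scoped Classical

universe u

noncomputable section

variable {α : Type u}

/-- `f` and `g` order the elements of `S` the same way. -/
def SameOrderOn (S : Finset α) (f g : α → ℝ) : Prop :=
  ∀ x ∈ S, ∀ y ∈ S, (f x < f y ↔ g x < g y)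

/-- An ordering of `S` is an injection of `S` into `ℝ`. -/
def IsOrderingOn (S : Finset α) (σ : α → ℝ) : Prop :=
  Set.InjOn σ ↑S

/-- A ranking of `S` is a bijection from `S` onto `{1, …, |S|}`. -/
def IsRankingOn (S : Finset α) (π : α → ℝ) : Prop :=
  Set.BijOn π ↑S ((fun i : ℕ => (i : ℝ)) '' Set.Icc 1 S.card)

/-- The rankings `π` and `π'` of `S` differ by the move of a single vertex:
`π' = Ranking(v ↦ p ⊕ π|_{S∖{v}})` for some `v ∈ S` and half-integer `p`,
and the two rankings differ. -/
def SingleMove (S : Finset α) (π π' : α → ℝ) : Prop :=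
  ∃ v ∈ S, ∃ p : ℝ, (∃ m : ℤ, p = (m : ℝ) + 1 / 2) ∧
    SameOrderOn S π' (Function.update π v p) ∧ ∃ x ∈ S, π x ≠ π' x

/-- The rankings `π` and `π'` of `S` differ by one of the four weak single-vertex moves:
swap the first two vertices, swap the last two, or move the first or last vertex to the
other end; formally `π' = Ranking(v ↦ p ⊕ π|_{S∖{v}})` with
`(π v, p) ∈ {(1, 2+1/2), (1, k+1/2), (k, k−3/2), (k, 1/2)}` where `k = |S|`. -/
def WeakMove (S : Finset α) (π π' : α → ℝ) : Prop :=
  ∃ v ∈ S, ∃ p : ℝ,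
    ((π v = 1 ∧ p = 2 + 1 / 2) ∨ (π v = 1 ∧ p = (S.card : ℝ) + 1 / 2) ∨
      (π v = (S.card : ℝ) ∧ p = (S.card : ℝ) - 3 / 2) ∨
      (π v = (S.card : ℝ) ∧ p = 1 / 2)) ∧
    SameOrderOn S π' (Function.update π v p) ∧ ∃ x ∈ S, π x ≠ π' x

/-- A constraint `c` on `S` is fragile if any two rankings of `S` differing by the move of
a single vertex satisfy `c π + c π' ≥ 1`. -/
def FragileOn (S : Finset α) (c : (α → ℝ) → ℕ) : Prop :=
  ∀ π π' : α → ℝ, IsRankingOn S π → IsRankingOn S π' → SingleMove S π π' → 1 ≤ c π + c π'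

/-- A constraint `c` on `S` is weakly fragile if any two rankings of `S` differing by one of
the four weak moves satisfy `c π + c π' ≥ 1`. -/
def WeaklyFragileOn (S : Finset α) (c : (α → ℝ) → ℕ) : Prop :=
  ∀ π π' : α → ℝ, IsRankingOn S π → IsRankingOn S π' → WeakMove S π π' → 1 ≤ c π + c π'

/-- A (fully dense) arity-`k` constraint system on `U`: to every `k`-subset `S` of `U` it
assigns a `{0,1}`-valued cost `c S` which depends only on the relative order of its
argument on `S` (so `c S σ` is the cost of the ranking of `S` induced by `σ`). -/
def IsConstraintSystem (U : Finset α) (k : ℕ) (c : Finset α → (α → ℝ) → ℕ) : Prop :=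
  ∀ S ∈ U.powersetCard k,
    (∀ σ : α → ℝ, c S σ ≤ 1) ∧ ∀ σ σ' : α → ℝ, SameOrderOn S σ σ' → c S σ = c S σ'

/-- Every constraint of the system is weakly fragile. -/
def WeaklyFragileSystem (U : Finset α) (k : ℕ) (c : Finset α → (α → ℝ) → ℕ) : Prop :=
  ∀ S ∈ U.powersetCard k, WeaklyFragileOn S (c S)

/-- The cost `C^c(σ) = Σ_{S ⊆ U, |S| = k} c(σ|_S)` of an ordering `σ`. -/
def cost (U : Finset α) (k : ℕ) (c : Finset α → (α → ℝ) → ℕ) (σ : α → ℝ) : ℕ :=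
  ∑ S ∈ U.powersetCard k, c S σ

/-- `b^c(σ, v, p) = Σ_{Q ⊆ U∖{v}, |Q| = k−1} c(σ|_Q ⊕ v ↦ p)`: the cost of the
constraints involving `v` after moving `v` to position `p` (here `U` is the domain of `σ`). -/
def bcost (U : Finset α) (k : ℕ) (c : Finset α → (α → ℝ) → ℕ) (σ : α → ℝ) (v : α) (p : ℝ) : ℕ :=
  ∑ Q ∈ (U.erase v).powersetCard (k - 1), c (insert v Q) (Function.update σ v p)

/-- The rank of `x` within `S` under the ordering `σ`. -/
def rk (S : Finset α) (σ : α → ℝ) (x : α) : ℕ :=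
  (S.filter fun y => σ y ≤ σ x).card

/-- The ordering of `S` obtained from `σ` by moving `v` to a position immediately
before `u` (all other vertices of `S` keeping their relative order). -/
def moveBefore (S : Finset α) (σ : α → ℝ) (v u : α) : α → ℝ :=
  Function.update (fun x => (rk S σ x : ℝ)) v ((rk S σ u : ℝ) - 1 / 2)

/-- The feedback-arc-set weight `w^σ_{uv}`: the number of `k`-subsets
`{u,v} ⊆ S ⊆ U` with `c(σ') = 1`, where `σ' = σ|_{S∖{v}} ⊕ v ↦ p` and `p` places `v`
immediately before `u` if `σ v > σ u`, and `p = σ v` otherwise. -/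
def wgt (U : Finset α) (k : ℕ) (c : Finset α → (α → ℝ) → ℕ) (σ : α → ℝ) (u v : α) : ℕ :=
  ((U.powersetCard k).filter fun S =>
    u ∈ S ∧ v ∈ S ∧ if σ u < σ v then c S (moveBefore S σ v u) = 1 else c S σ = 1).card

/-- The canceled weights
`w̄^σ_{uv} = w^σ_{uv} − min((1/(10·3^{k−1}))·C(|U|−2, k−2), w^σ_{uv}, w^σ_{vu})`. -/
def wbar (U : Finset α) (k : ℕ) (c : Finset α → (α → ℝ) → ℕ) (σ : α → ℝ) (u v : α) : ℝ :=
  (wgt U k c σ u v : ℝ) -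
    min (1 / (10 * 3 ^ (k - 1)) * ((U.card - 2).choose (k - 2) : ℝ))
      (min (wgt U k c σ u v : ℝ) (wgt U k c σ v u : ℝ))

/-- The feedback-arc-set cost `C^w(σ) = Σ_{u,v ∈ U : σ(u) > σ(v)} w_{uv}`. -/
def costW (U : Finset α) (w : α → α → ℝ) (σ : α → ℝ) : ℝ :=
  ∑ x ∈ U, ∑ y ∈ U, if σ y < σ x then w x y else 0

/-- `b^w(σ, v, p) = Σ_{u ≠ v} (w_{uv} if σ(u) > p, w_{vu} if σ(u) < p)`. -/
def bW (U : Finset α) (w : α → α → ℝ) (σ : α → ℝ) (v : α) (p : ℝ) : ℝ :=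
  ∑ x ∈ U.erase v, if p < σ x then w x v else if σ x < p then w v x else 0

/-- The Kendall tau distance: the number of `σ/σ'`-inversions, i.e. of unordered pairs
`{u,v} ⊆ S` on which `σ` and `σ'` disagree. -/
def kendall (S : Finset α) (σ σ' : α → ℝ) : ℕ :=
  ((S ×ˢ S).filter fun q => σ q.1 < σ q.2 ∧ σ' q.2 < σ' q.1).card

/-- `Round(π)`: each position is rounded down to the nearest multiple of `e = εn`, with
ties broken by adding `u/(n+1)`. -/
def roundOrd (n e : ℕ) (π : ℕ → ℝ) : ℕ → ℝ :=
  fun u => (e : ℝ) * (⌊π u / (e : ℝ)⌋ : ℝ) + (u : ℝ) / ((n : ℝ) + 1)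

end

theorem IsRankingOn.one_le_le_card {α : Type u} {S : Finset α} {π : α → ℝ}
    (h : IsRankingOn S π) {x : α} (hx : x ∈ S) : 1 ≤ π x ∧ π x ≤ S.card := by
  obtain ⟨i, ⟨h1, h2⟩, hi⟩ := h.mapsTo (Finset.mem_coe.2 hx)
  simp only at hi
  rw [← hi]
  exact ⟨by exact_mod_cast h1, by exact_mod_cast h2⟩

theorem IsRankingOn.exists_eq {α : Type u} {S : Finset α} {π : α → ℝ}
    (h : IsRankingOn S π) {i : ℕ} (h1 : 1 ≤ i) (h2 : i ≤ S.card) : ∃ x ∈ S, π x = i :=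
  h.surjOn ⟨i, ⟨h1, h2⟩, rfl⟩

/-- A weak move takes the pair of extreme vertices `a`, `b` of a ranking to a pair which is no
longer extreme. -/
theorem WeakMove.not_extreme {α : Type u} {S : Finset α} {π π' : α → ℝ} {a b : α}
    (hk : 3 ≤ S.card) (ha : a ∈ S) (hb : b ∈ S) (hπ : IsRankingOn S π)
    (hπ' : IsRankingOn S π') (hm : WeakMove S π π') (h1 : π a = 1) (h2 : π b = S.card) :
    ¬ ((π' a = 1 ∧ π' b = S.card) ∨ (π' a = S.card ∧ π' b = 1)) := by
  obtain ⟨w, hw, p, hp, ho, -⟩ := hm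
  obtain ⟨x, hx, hx2⟩ := hπ.exists_eq (i := 2) (by omega) (by omega)
  obtain ⟨y, hy, hyk⟩ := hπ.exists_eq (i := S.card - 1) (by omega) (by omega)
  rw [Nat.cast_sub (by omega)] at hyk
  push_cast at hx2 hyk
  have hk' : (3 : ℝ) ≤ S.card := by exact_mod_cast hk
  have hab : a ≠ b := by rintro rfl; linarith
  have hxa : x ≠ a := by rintro rfl; linarith
  have hxb : x ≠ b := by rintro rfl; linarith
  have hya : y ≠ a := by rintro rfl; linarith
  have hyb : y ≠ b := by rintro rfl; linarith
  have bx := hπ'.one_le_le_card hx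
  have bY := hπ'.one_le_le_card hy
  have ba := hπ'.one_le_le_card ha
  have bb := hπ'.one_le_le_card hb
  have oab := ho a ha b hb
  have oba := ho b hb a ha
  have oxa := ho x hx a ha
  have oax := ho a ha x hx
  have oxb := ho x hx b hb
  have oby := ho b hb y hy
  have hwab : w = a ∨ w = b := by
    rcases hp with ⟨h, -⟩ | ⟨h, -⟩ | ⟨h, -⟩ | ⟨h, -⟩
    · exact Or.inl (hπ.injOn hw ha (h.trans h1.symm))
    · exact Or.inl (hπ.injOn hw ha (h.trans h1.symm))
    · exact Or.inr (hπ.injOn hw hb (h.trans h2.symm))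
    · exact Or.inr (hπ.injOn hw hb (h.trans h2.symm))
  rcases hwab with rfl | rfl
  · simp only [Function.update_self, Function.update_of_ne hab.symm,
      Function.update_of_ne hxa] at oab oba oxa oxb
    grind
  · simp only [Function.update_self, Function.update_of_ne hab,
      Function.update_of_ne hxb, Function.update_of_ne hyb] at oab oba oax oby
    grind

/-- the generalized betweenness constraint (the two designated vertices
`u ≠ v` must occupy the first and last positions of the `k`-element set `S`, `k ≥ 3`)
is weakly fragile. -/
theorem generalized_betweenness_weakly_fragile {α : Type u} (S : Finset α) (u v : α)
    (k : ℕ) (hk : 3 ≤ k) (hS : S.card = k) (hu : u ∈ S) (hv : v ∈ S) (huv : u ≠ v) :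
    WeaklyFragileOn S
      (fun π => if ({π u, π v} : Set ℝ) = {1, (k : ℝ)} then 0 else 1) := by
  intro π π' hπ hπ' hm
  subst hS
  by_contra hc
  have h : ({π u, π v} : Set ℝ) = {1, (S.card : ℝ)} := by
    by_contra h
    simp [h] at hc
  have h' : ({π' u, π' v} : Set ℝ) = {1, (S.card : ℝ)} := by
    by_contra h'
    simp [h'] at hc
  rw [Set.pair_eq_pair_iff] at h h'
  rcases h with ⟨h1, h2⟩ | ⟨h1, h2⟩
  · exact hm.not_extreme hk hu hv hπ hπ' h1 h2 h'
  · exact hm.not_extreme hk hv hu hπ hπ' h2 h1 (by tauto)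
end

section
/- Let c be an arity-k constraint system (k ≥ 2) on a finite vertex set U and let σ be an ordering of U. Then C^{w^σ}(σ) = C(k,2) · C^c(σ), where C(k,2) is the binomial coefficient 'k choose 2'. -/
open scoped Classical

universe u

/-- An injective ordering of a finite set `S` has exactly `C(|S|, 2)` strictly ordered pairs. -/
theorem card_filter_lt_eq_choose_two {α : Type u} (S : Finset α) (σ : α → ℝ)
    (hσ : IsOrderingOn S σ) :
    ((S ×ˢ S).filter fun q => σ q.2 < σ q.1).card = S.card.choose 2 := by
  have hswap : ((S ×ˢ S).filter fun q => σ q.1 < σ q.2).card =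
      ((S ×ˢ S).filter fun q => σ q.2 < σ q.1).card := by
    refine Finset.card_bij (fun q _ => q.swap) ?_ (fun _ _ _ _ h => Prod.swap_injective h)
      (fun q hq => ⟨q.swap, ?_, q.swap_swap⟩) <;> simp_all
  have hunion : S.offDiag = ((S ×ˢ S).filter fun q => σ q.1 < σ q.2) ∪
      ((S ×ˢ S).filter fun q => σ q.2 < σ q.1) := by
    ext ⟨x, y⟩
    simp only [Finset.mem_offDiag, Finset.mem_union, Finset.mem_filter, Finset.mem_product]
    constructor
    · rintro ⟨hx, hy, hxy⟩
      have hne : σ x ≠ σ y := fun h => hxy (hσ hx hy h)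
      rcases lt_or_gt_of_ne hne with h | h
      · exact Or.inl ⟨⟨hx, hy⟩, h⟩
      · exact Or.inr ⟨⟨hx, hy⟩, h⟩
    · rintro (⟨⟨hx, hy⟩, h⟩ | ⟨⟨hx, hy⟩, h⟩) <;>
        exact ⟨hx, hy, by rintro rfl; exact lt_irrefl _ h⟩
  have hdisj : Disjoint ((S ×ˢ S).filter fun q => σ q.1 < σ q.2)
      ((S ×ˢ S).filter fun q => σ q.2 < σ q.1) :=
    Finset.disjoint_filter.2 fun _ _ h => h.not_gt
  have hcard := S.offDiag_card
  rw [hunion, Finset.card_union_of_disjoint hdisj, hswap] at hcard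
  rw [Nat.choose_two_right, Nat.mul_sub_one, ← hcard]
  omega

/-- On a pair with `σ y < σ x`, the weight `w^σ_{xy}` counts the violated constraints
containing both `x` and `y`. -/
theorem wgt_eq_sum_of_lt {α : Type u} {U : Finset α} {k : ℕ}
    {c : Finset α → (α → ℝ) → ℕ} (hc : IsConstraintSystem U k c) {σ : α → ℝ} {x y : α}
    (h : σ y < σ x) :
    wgt U k c σ x y = ∑ S ∈ U.powersetCard k, if x ∈ S ∧ y ∈ S then c S σ else 0 := by
  rw [wgt, Finset.card_filter]
  refine Finset.sum_congr rfl fun S hS => ?_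
  have hle := (hc S hS).1 σ
  simp only [if_neg h.not_gt]
  split_ifs <;> grind

/-- `C^{w^σ}(σ) = C(k,2) · C^c(σ)` for every arity-`k` constraint system
`c` on `U` and every ordering `σ` of `U`. -/
theorem costW_wgt_eq_choose_mul_cost {α : Type u} (U : Finset α) (k : ℕ) (hk : 2 ≤ k)
    (c : Finset α → (α → ℝ) → ℕ) (hc : IsConstraintSystem U k c)
    (σ : α → ℝ) (hσ : IsOrderingOn U σ) :
    costW U (fun x y => (wgt U k c σ x y : ℝ)) σ
      = (k.choose 2 : ℝ) * (cost U k c σ : ℝ) := by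
  have hcost : costW U (fun x y => (wgt U k c σ x y : ℝ)) σ =
      ((∑ q ∈ U ×ˢ U, ∑ S ∈ U.powersetCard k,
        if σ q.2 < σ q.1 ∧ q.1 ∈ S ∧ q.2 ∈ S then c S σ else 0 : ℕ) : ℝ) := by
    rw [costW, ← Finset.sum_product', Nat.cast_sum]
    refine Finset.sum_congr rfl fun q _ => ?_
    by_cases h : σ q.2 < σ q.1
    · simp [h, wgt_eq_sum_of_lt hc h]
    · simp [h]
  rw [hcost, Finset.sum_comm, cost, ← Nat.cast_mul, Finset.mul_sum]
  congr 1
  refine Finset.sum_congr rfl fun S hS => ?_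
  obtain ⟨hSU, hSk⟩ := Finset.mem_powersetCard.1 hS
  have hfilter : ((U ×ˢ U).filter fun q => σ q.2 < σ q.1 ∧ q.1 ∈ S ∧ q.2 ∈ S) =
      (S ×ˢ S).filter fun q => σ q.2 < σ q.1 := by
    ext q
    simp only [Finset.mem_filter, Finset.mem_product]
    exact ⟨fun h => ⟨h.2.2, h.2.1⟩, fun h => ⟨⟨hSU h.1.1, hSU h.1.2⟩, h.2, h.1⟩⟩
  rw [← Finset.sum_filter, Finset.sum_const, smul_eq_mul, hfilter,
    card_filter_lt_eq_choose_two S σ (hσ.mono (Finset.coe_subset.2 hSU)), hSk]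
end

section
/- Let c be an arity-k constraint system (k ≥ 2) on a finite vertex set U, let σ be an ordering of U, and let v ∈ U. Then b^{w^σ}(σ, v, σ(v)) = (k − 1) · b^c(σ, v, σ(v)). -/
open scoped Classical

universe u

/-- If `u` does not precede `v`, the weight `wgt U k c σ u v` counts the sets containing
both vertices whose constraint is violated by `σ` itself. -/
theorem wgt_eq_card_of_not_lt {α : Type u} (U : Finset α) (k : ℕ)
    (c : Finset α → (α → ℝ) → ℕ) (σ : α → ℝ) {u v : α} (h : ¬σ u < σ v) :
    wgt U k c σ u v
      = ((U.powersetCard k).filter fun S => u ∈ S ∧ v ∈ S ∧ c S σ = 1).card := by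
  simp only [wgt, if_neg h]

/-- At the current position of `v`, `bcost` counts the violated constraints containing `v`. -/
theorem bcost_self_eq_card {α : Type u} (U : Finset α) (k : ℕ) (hk : 1 ≤ k)
    (c : Finset α → (α → ℝ) → ℕ) (hc : IsConstraintSystem U k c) (σ : α → ℝ)
    {v : α} (hv : v ∈ U) :
    bcost U k c σ v (σ v)
      = ((U.powersetCard k).filter fun S => v ∈ S ∧ c S σ = 1).card := by
  rw [← Finset.filter_filter, Finset.card_filter, bcost, Function.update_eq_self]
  refine Finset.sum_bij' (fun Q _ => insert v Q) (fun S _ => S.erase v) ?_ ?_ ?_ ?_ ?_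
  · intro Q hQ
    rw [Finset.mem_powersetCard] at hQ
    have hvQ : v ∉ Q := fun h => Finset.notMem_erase v U (hQ.1 h)
    rw [Finset.mem_filter, Finset.mem_powersetCard, Finset.card_insert_of_notMem hvQ]
    exact ⟨⟨Finset.insert_subset hv (hQ.1.trans (Finset.erase_subset v U)), by omega⟩,
      Finset.mem_insert_self v Q⟩
  · intro S hS
    rw [Finset.mem_filter, Finset.mem_powersetCard] at hS
    rw [Finset.mem_powersetCard, Finset.card_erase_of_mem hS.2, hS.1.2]
    exact ⟨Finset.erase_subset_erase v hS.1.1, rfl⟩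
  · intro Q hQ
    rw [Finset.mem_powersetCard] at hQ
    exact Finset.erase_insert fun h => Finset.notMem_erase v U (hQ.1 h)
  · intro S hS
    exact Finset.insert_erase (Finset.mem_filter.1 hS).2
  · intro Q hQ
    rw [Finset.mem_powersetCard] at hQ
    have hvQ : v ∉ Q := fun h => Finset.notMem_erase v U (hQ.1 h)
    have hS : insert v Q ∈ U.powersetCard k := by
      rw [Finset.mem_powersetCard, Finset.card_insert_of_notMem hvQ]
      exact ⟨Finset.insert_subset hv (hQ.1.trans (Finset.erase_subset v U)), by omega⟩
    have hle := (hc _ hS).1 σ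
    split_ifs <;> omega

/-- Double counting of the pairs `x ∈ S` with `x ≠ v`, over a family `F` of `k`-sets
containing `v`. -/
theorem sum_card_filter_mem_erase {α : Type u} (U : Finset α) (k : ℕ) (v : α)
    (F : Finset (Finset α)) (hF : ∀ S ∈ F, S ∈ U.powersetCard k ∧ v ∈ S) :
    ∑ x ∈ U.erase v, (F.filter fun S => x ∈ S).card = (k - 1) * F.card := by
  have h := Finset.sum_card_bipartiteAbove_eq_sum_card_bipartiteBelow
    (s := U.erase v) (t := F) (fun x S => x ∈ S)
  simp only [Finset.bipartiteAbove, Finset.bipartiteBelow] at h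
  rw [h, mul_comm, ← smul_eq_mul]
  refine Finset.sum_eq_card_nsmul fun S hS => ?_
  obtain ⟨hSU, hvS⟩ := hF S hS
  rw [Finset.mem_powersetCard] at hSU
  rw [Finset.filter_mem_eq_inter, Finset.inter_comm, Finset.inter_erase,
    Finset.inter_eq_left.2 hSU.1, Finset.card_erase_of_mem hvS, hSU.2]

/-- `b^{w^σ}(σ, v, σ(v)) = (k − 1) · b^c(σ, v, σ(v))` for every arity-`k`
constraint system `c` on `U`, every ordering `σ` of `U` and every `v ∈ U`. -/
theorem bW_wgt_eq_mul_bcost {α : Type u} (U : Finset α) (k : ℕ) (hk : 2 ≤ k)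
    (c : Finset α → (α → ℝ) → ℕ) (hc : IsConstraintSystem U k c)
    (σ : α → ℝ) (hσ : IsOrderingOn U σ) (v : α) (hv : v ∈ U) :
    bW U (fun x y => (wgt U k c σ x y : ℝ)) σ v (σ v)
      = ((k - 1 : ℕ) : ℝ) * (bcost U k c σ v (σ v) : ℝ) := by
  rw [bcost_self_eq_card U k (by omega) c hc σ hv, ← Nat.cast_mul,
    ← sum_card_filter_mem_erase U k v _ fun S hS =>
      ⟨(Finset.mem_filter.1 hS).1, (Finset.mem_filter.1 hS).2.1⟩, Nat.cast_sum, bW]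
  refine Finset.sum_congr rfl fun x hx => ?_
  obtain ⟨hxv, hxU⟩ := Finset.mem_erase.1 hx
  rw [Finset.filter_filter]
  split_ifs with h₁ h₂
  · rw [wgt_eq_card_of_not_lt U k c σ h₁.not_gt]
    congr 2
    exact Finset.filter_congr fun S _ => by tauto
  · rw [wgt_eq_card_of_not_lt U k c σ h₂.not_gt]
    congr 2
    exact Finset.filter_congr fun S _ => by tauto
  · exact absurd (hσ hxU hv (le_antisymm (not_lt.1 h₁) (not_lt.1 h₂))) hxv
end

section
/- For every k ≥ 2 there exists n₀ such that the following holds for all n ≥ n₀. Let c be a fully dense weakly fragile arity-k constraint system on a vertex set V with |V| = n, let σ be an ordering of V, let v ∈ V, and let p, p' ∈ ℝ. Let B be the set of vertices of V ∖ {v} whose σ-position lies strictly between p and p'. Then b^c(σ, v, p) + b^c(σ, v, p') ≥ (|B| / ((n−1) · 3^{k−1})) · C(n−1, k−1), where C(n−1,k−1) is the binomial coefficient. -/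
open scoped Classical

universe u

section

variable {α : Type u} {S : Finset α} {f g : α → ℝ} {v : α}

theorem rk_lt_rk_iff {x y : α} (hy : y ∈ S) :
    rk S f x < rk S f y ↔ f x < f y := by
  constructor
  · intro h
    by_contra! hle
    refine absurd (Finset.card_le_card ?_) (not_le.mpr h)
    intro z hz
    simp only [Finset.mem_filter] at hz ⊢
    exact ⟨hz.1, hz.2.trans hle⟩
  · intro h
    refine Finset.card_lt_card ?_
    rw [Finset.ssubset_iff_of_subset]
    · exact ⟨y, by simp [hy], by simp [h]⟩
    · intro z hz
      simp only [Finset.mem_filter] at hz ⊢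
      exact ⟨hz.1, hz.2.trans h.le⟩

theorem sameOrderOn_rk (S : Finset α) (f : α → ℝ) :
    SameOrderOn S f (fun x => (rk S f x : ℝ)) := by
  intro x hx y hy
  rw [Nat.cast_lt, rk_lt_rk_iff hy]

theorem isRankingOn_rk (hf : IsOrderingOn S f) :
    IsRankingOn S (fun x => (rk S f x : ℝ)) := by
  have hmaps : ∀ x ∈ S, rk S f x ∈ Finset.Icc 1 S.card := by
    intro x hx
    rw [Finset.mem_Icc]
    exact ⟨Finset.card_pos.mpr ⟨x, by simp [hx]⟩, Finset.card_filter_le _ _⟩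
  have hinj : Set.InjOn (rk S f) S := by
    intro x hx y hy hxy
    apply hf hx hy
    have h1 := rk_lt_rk_iff (f := f) (x := x) hy
    have h2 := rk_lt_rk_iff (f := f) (x := y) hx
    rw [hxy] at h1 h2
    simp only [lt_irrefl, false_iff, not_lt] at h1 h2
    exact le_antisymm h2 h1
  have hsurj : Set.SurjOn (rk S f) S (Finset.Icc 1 S.card : Finset ℕ) :=
    Finset.surjOn_of_injOn_of_card_le _ hmaps hinj (by simp)
  refine ⟨?_, ?_, ?_⟩
  · intro x hx
    exact ⟨rk S f x, by simpa using hmaps x hx, rfl⟩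
  · intro x hx y hy hxy
    exact hinj hx hy (Nat.cast_injective (R := ℝ) hxy)
  · rintro _ ⟨i, hi, rfl⟩
    obtain ⟨x, hx, rfl⟩ := hsurj (by simpa using hi)
    exact ⟨x, hx, rfl⟩

theorem WeaklyFragileOn.one_le_add {c : (α → ℝ) → ℕ} (hw : WeaklyFragileOn S c)
    (hc : ∀ σ σ' : α → ℝ, SameOrderOn S σ σ' → c σ = c σ')
    (hf : IsOrderingOn S f) (hg : IsOrderingOn S g) (hv : v ∈ S)
    (hfg : ∀ y ∈ S, y ≠ v → f y = g y) {q : ℝ}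
    (hq : ((rk S f v : ℝ) = 1 ∧ q = 2 + 1 / 2) ∨
      ((rk S f v : ℝ) = 1 ∧ q = (S.card : ℝ) + 1 / 2) ∨
      ((rk S f v : ℝ) = (S.card : ℝ) ∧ q = (S.card : ℝ) - 3 / 2) ∨
      ((rk S f v : ℝ) = (S.card : ℝ) ∧ q = 1 / 2))
    (hmove : ∀ y ∈ S, y ≠ v →
      (g v < g y ↔ q < rk S f y) ∧ (g y < g v ↔ (rk S f y : ℝ) < q))
    (hflip : ∃ y ∈ S, (f v < f y ∧ g y < g v) ∨ (f y < f v ∧ g v < g y)) :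
    1 ≤ c f + c g := by
  rw [hc f _ (sameOrderOn_rk S f), hc g _ (sameOrderOn_rk S g)]
  refine hw _ _ (isRankingOn_rk hf) (isRankingOn_rk hg) ⟨v, hv, q, hq, ?_, ?_⟩
  · intro x hx y hy
    rw [Nat.cast_lt, rk_lt_rk_iff hy]
    by_cases hxv : x = v
    · subst hxv
      by_cases hyv : y = x
      · subst hyv; simp
      · simp [Function.update_of_ne hyv, (hmove y hy hyv).1]
    · by_cases hyv : y = v
      · subst hyv
        simp [Function.update_of_ne hxv, (hmove x hx hxv).2]
      · rw [Function.update_of_ne hxv, Function.update_of_ne hyv, Nat.cast_lt,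
          rk_lt_rk_iff hy, hfg x hx hxv, hfg y hy hyv]
  · by_contra! h
    have h' : ∀ x ∈ S, rk S f x = rk S g x := fun x hx => Nat.cast_injective (R := ℝ) (h x hx)
    obtain ⟨y, hy, h1 | h1⟩ := hflip
    · have h2 := (rk_lt_rk_iff hy).2 h1.1
      rw [h' v hv, h' y hy, rk_lt_rk_iff hy] at h2
      exact lt_asymm h2 h1.2
    · have h2 := (rk_lt_rk_iff hv).2 h1.1
      rw [h' v hv, h' y hy, rk_lt_rk_iff hv] at h2
      exact lt_asymm h2 h1.2

theorem rk_eq_one_of_first (hv : v ∈ S) (hfirst : ∀ y ∈ S, y ≠ v → f v < f y) :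
    rk S f v = 1 := by
  rw [rk, Finset.card_eq_one]
  refine ⟨v, ?_⟩
  ext y
  simp only [Finset.mem_filter, Finset.mem_singleton]
  constructor
  · rintro ⟨hy, hle⟩
    by_contra hyv
    exact absurd (hfirst y hy hyv) (not_lt.mpr hle)
  · rintro rfl
    exact ⟨hv, le_rfl⟩

theorem rk_eq_card_of_last (hlast : ∀ y ∈ S, y ≠ v → f y < f v) :
    rk S f v = S.card := by
  rw [rk, Finset.filter_true_of_mem]
  intro y hy
  by_cases hyv : y = v
  · rw [hyv]
  · exact (hlast y hy hyv).le

theorem WeaklyFragileOn.one_le_add_of_first_last {c : (α → ℝ) → ℕ} (hw : WeaklyFragileOn S c)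
    (hc : ∀ σ σ' : α → ℝ, SameOrderOn S σ σ' → c σ = c σ')
    (hf : IsOrderingOn S f) (hg : IsOrderingOn S g) (hv : v ∈ S)
    (hfg : ∀ y ∈ S, y ≠ v → f y = g y) (hne : ∃ y ∈ S, y ≠ v)
    (hfirst : ∀ y ∈ S, y ≠ v → f v < f y) (hlast : ∀ y ∈ S, y ≠ v → g y < g v) :
    1 ≤ c f + c g := by
  refine hw.one_le_add hc hf hg hv hfg (q := (S.card : ℝ) + 1 / 2)
    (Or.inr (Or.inl ⟨by rw [rk_eq_one_of_first hv hfirst, Nat.cast_one], rfl⟩)) ?_ ?_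
  · intro y hy hyv
    have h1 : (rk S f y : ℝ) ≤ S.card := Nat.cast_le.mpr (Finset.card_filter_le _ _)
    have h2 := hlast y hy hyv
    exact ⟨iff_of_false h2.not_gt (by linarith), iff_of_true h2 (by linarith)⟩
  · obtain ⟨y, hy, hyv⟩ := hne
    exact ⟨y, hy, Or.inl ⟨hfirst y hy hyv, hlast y hy hyv⟩⟩

theorem WeaklyFragileOn.one_le_add_of_first_second {c : (α → ℝ) → ℕ} (hw : WeaklyFragileOn S c)
    (hc : ∀ σ σ' : α → ℝ, SameOrderOn S σ σ' → c σ = c σ')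
    (hf : IsOrderingOn S f) (hg : IsOrderingOn S g) (hv : v ∈ S)
    (hfg : ∀ y ∈ S, y ≠ v → f y = g y) {w : α} (hwS : w ∈ S) (hwv : w ≠ v)
    (hfirst : ∀ y ∈ S, y ≠ v → f v < f y) (hlt : g w < g v)
    (hgt : ∀ y ∈ S, y ≠ v → y ≠ w → g v < g y) :
    1 ≤ c f + c g := by
  have hrk : rk S f w = 2 := by
    rw [rk, Finset.card_eq_two]
    refine ⟨v, w, hwv.symm, ?_⟩
    ext y
    simp only [Finset.mem_filter, Finset.mem_insert, Finset.mem_singleton]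
    constructor
    · rintro ⟨hy, hle⟩
      by_contra! h
      have := hgt y hy h.1 h.2
      rw [hfg y hy h.1, hfg w hwS hwv] at hle
      linarith
    · rintro (rfl | rfl)
      · exact ⟨hv, (hfirst w hwS hwv).le⟩
      · exact ⟨hwS, le_rfl⟩
  refine hw.one_le_add hc hf hg hv hfg (q := 2 + 1 / 2)
    (Or.inl ⟨by rw [rk_eq_one_of_first hv hfirst, Nat.cast_one], rfl⟩) ?_
    ⟨w, hwS, Or.inl ⟨hfirst w hwS hwv, hlt⟩⟩
  intro y hy hyv
  by_cases hyw : y = w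
  · subst hyw
    rw [hrk]
    exact ⟨iff_of_false hlt.not_gt (by norm_num), iff_of_true hlt (by norm_num)⟩
  · have h1 := hgt y hy hyv hyw
    have h2 : rk S f w < rk S f y := by
      rw [rk_lt_rk_iff hy, hfg y hy hyv, hfg w hwS hwv]
      exact hlt.trans h1
    rw [hrk] at h2
    have h3 : (3 : ℝ) ≤ rk S f y := by exact_mod_cast h2
    exact ⟨iff_of_true h1 (by linarith), iff_of_false h1.not_gt (by linarith)⟩

theorem WeaklyFragileOn.one_le_add_of_last_penultimate {c : (α → ℝ) → ℕ}
    (hw : WeaklyFragileOn S c) (hc : ∀ σ σ' : α → ℝ, SameOrderOn S σ σ' → c σ = c σ')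
    (hf : IsOrderingOn S f) (hg : IsOrderingOn S g) (hv : v ∈ S)
    (hfg : ∀ y ∈ S, y ≠ v → f y = g y) {w : α} (hwS : w ∈ S) (hwv : w ≠ v)
    (hlast : ∀ y ∈ S, y ≠ v → f y < f v) (hgt : g v < g w)
    (hlt : ∀ y ∈ S, y ≠ v → y ≠ w → g y < g v) :
    1 ≤ c f + c g := by
  have hrk : rk S f w + 1 = S.card := by
    have h : S.filter (fun y => f y ≤ f w) = S.erase v := by
      ext y
      simp only [Finset.mem_filter, Finset.mem_erase]
      constructor
      · rintro ⟨hy, hle⟩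
        refine ⟨?_, hy⟩
        rintro rfl
        exact absurd (hlast w hwS hwv) (not_lt.mpr hle)
      · rintro ⟨hyv, hy⟩
        refine ⟨hy, ?_⟩
        by_cases hyw : y = w
        · rw [hyw]
        · rw [hfg y hy hyv, hfg w hwS hwv]
          exact ((hlt y hy hyv hyw).trans hgt).le
    rw [rk, h, Finset.card_erase_add_one hv]
  have hrk' : (rk S f w : ℝ) + 1 = S.card := by exact_mod_cast hrk
  refine hw.one_le_add hc hf hg hv hfg (q := (S.card : ℝ) - 3 / 2)
    (Or.inr (Or.inr (Or.inl ⟨by rw [rk_eq_card_of_last hlast], rfl⟩))) ?_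
    ⟨w, hwS, Or.inr ⟨hlast w hwS hwv, hgt⟩⟩
  intro y hy hyv
  by_cases hyw : y = w
  · subst hyw
    exact ⟨iff_of_true hgt (by linarith), iff_of_false hgt.not_gt (by linarith)⟩
  · have h1 := hlt y hy hyv hyw
    have h2 : rk S f y < rk S f w := by
      rw [rk_lt_rk_iff hwS, hfg y hy hyv, hfg w hwS hwv]
      exact h1.trans hgt
    have h3 : (rk S f y : ℝ) + 1 ≤ rk S f w := by exact_mod_cast h2
    exact ⟨iff_of_false h1.not_gt (by linarith), iff_of_true h1 (by linarith)⟩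

end

section

variable {α : Type u}

theorem card_le_bcost_add_bcost {V : Finset α} {k : ℕ} {c : Finset α → (α → ℝ) → ℕ}
    {σ : α → ℝ} {v : α} {p p' : ℝ} {F : Finset (Finset α)}
    (hF : F ⊆ (V.erase v).powersetCard (k - 1))
    (h : ∀ Q ∈ F,
      1 ≤ c (insert v Q) (Function.update σ v p) + c (insert v Q) (Function.update σ v p')) :
    F.card ≤ bcost V k c σ v p + bcost V k c σ v p' := by
  rw [bcost, bcost, ← Finset.sum_add_distrib, Finset.card_eq_sum_ones]
  exact (Finset.sum_le_sum h).trans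
    (Finset.sum_le_sum_of_subset_of_nonneg hF fun _ _ _ => Nat.zero_le _)

theorem card_image_insert_powersetCard {B R : Finset α} (hBR : Disjoint B R) (d : ℕ) :
    ((B ×ˢ R.powersetCard d).image fun q => insert q.1 q.2).card =
      B.card * R.card.choose d := by
  rw [Finset.card_image_of_injOn, Finset.card_product, Finset.card_powersetCard]
  rintro ⟨x, P⟩ hx ⟨y, Q⟩ hy hxy
  simp only [Finset.coe_product, Set.mem_prod, Finset.mem_coe, Finset.mem_powersetCard] at hx hy
  have hQ : ∀ {z : α} {T : Finset α}, z ∈ B → T ⊆ R → z ∉ T := fun hz hT h =>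
    Finset.disjoint_left.mp hBR hz (hT h)
  dsimp only at hxy
  have hxyeq : x = y := by
    have h : x ∈ insert y Q := hxy ▸ Finset.mem_insert_self x P
    exact (Finset.mem_insert.mp h).resolve_right (hQ hx.1 hy.2.1)
  subst hxyeq
  have hPQ : P = Q := by
    rw [← Finset.erase_insert (hQ hx.1 hx.2.1), hxy, Finset.erase_insert (hQ hy.1 hy.2.1)]
  rw [hPQ]

theorem isOrderingOn_update {V Q : Finset α} {σ : α → ℝ} {v : α} {p : ℝ}
    (hσ : IsOrderingOn V σ) (hp : ∀ x ∈ V.erase v, σ x ≠ p) (hQ : Q ⊆ V.erase v) :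
    IsOrderingOn (insert v Q) (Function.update σ v p) := by
  have hne : ∀ x ∈ insert v Q, x ≠ v → x ∈ V.erase v := fun x hx hxv =>
    hQ ((Finset.mem_insert.mp hx).resolve_left hxv)
  intro x hx y hy hxy
  by_cases hxv : x = v <;> by_cases hyv : y = v
  · rw [hxv, hyv]
  · subst hxv
    rw [Function.update_self, Function.update_of_ne hyv] at hxy
    exact absurd hxy.symm (hp y (hne y hy hyv))
  · subst hyv
    rw [Function.update_self, Function.update_of_ne hxv] at hxy
    exact absurd hxy (hp x (hne x hx hxv))
  · rw [Function.update_of_ne hxv, Function.update_of_ne hyv] at hxy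
    exact hσ (Finset.mem_of_mem_erase (hne x hx hxv)) (Finset.mem_of_mem_erase (hne y hy hyv)) hxy

section

variable {V : Finset α} {d : ℕ} {c : Finset α → (α → ℝ) → ℕ} {σ : α → ℝ} {v : α} {p p' : ℝ}

theorem choose_card_between_le (hc : IsConstraintSystem V (d + 2) c)
    (hw : WeaklyFragileSystem V (d + 2) c) (hσ : IsOrderingOn V σ) (hv : v ∈ V)
    (hp : ∀ x ∈ V.erase v, σ x ≠ p) (hp' : ∀ x ∈ V.erase v, σ x ≠ p') :
    ((V.erase v).filter fun x => p < σ x ∧ σ x < p').card.choose (d + 1) ≤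
      bcost V (d + 2) c σ v p + bcost V (d + 2) c σ v p' := by
  rw [← Finset.card_powersetCard]
  have hsub : (((V.erase v).filter fun x => p < σ x ∧ σ x < p').powersetCard (d + 1)) ⊆
      (V.erase v).powersetCard (d + 2 - 1) :=
    Finset.powersetCard_mono (Finset.filter_subset _ _)
  refine card_le_bcost_add_bcost hsub ?_
  intro Q hQF
  obtain ⟨hQ, hQc⟩ := Finset.mem_powersetCard.mp (hsub hQF)
  have hQB := (Finset.mem_powersetCard.mp hQF).1
  have hvQ : v ∉ Q := fun h => Finset.notMem_erase v V (hQ h)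
  have hS : insert v Q ∈ V.powersetCard (d + 2) := by
    rw [Finset.mem_powersetCard, Finset.card_insert_of_notMem hvQ]
    exact ⟨Finset.insert_subset hv (hQ.trans (Finset.erase_subset _ _)), by omega⟩
  have hmem : ∀ y ∈ insert v Q, y ≠ v → p < σ y ∧ σ y < p' := fun y hy hyv =>
    (Finset.mem_filter.mp (hQB ((Finset.mem_insert.mp hy).resolve_left hyv))).2
  refine (hw _ hS).one_le_add_of_first_last (hc _ hS).2 (isOrderingOn_update hσ hp hQ)
    (isOrderingOn_update hσ hp' hQ) (Finset.mem_insert_self v Q) ?_ ?_ ?_ ?_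
  · intro y _ hyv
    rw [Function.update_of_ne hyv, Function.update_of_ne hyv]
  · obtain ⟨y, hy⟩ := Finset.card_pos.mp (show 0 < Q.card by omega)
    exact ⟨y, Finset.mem_insert_of_mem hy, fun h => hvQ (h ▸ hy)⟩
  · intro y hy hyv
    rw [Function.update_self, Function.update_of_ne hyv]
    exact (hmem y hy hyv).1
  · intro y hy hyv
    rw [Function.update_self, Function.update_of_ne hyv]
    exact (hmem y hy hyv).2

theorem card_between_mul_choose_card_above_le (hc : IsConstraintSystem V (d + 2) c)
    (hw : WeaklyFragileSystem V (d + 2) c) (hσ : IsOrderingOn V σ) (hv : v ∈ V)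
    (hp : ∀ x ∈ V.erase v, σ x ≠ p) (hp' : ∀ x ∈ V.erase v, σ x ≠ p') (hpp' : p < p') :
    ((V.erase v).filter fun x => p < σ x ∧ σ x < p').card *
        ((V.erase v).filter fun x => p' < σ x).card.choose d ≤
      bcost V (d + 2) c σ v p + bcost V (d + 2) c σ v p' := by
  have hdisj : Disjoint ((V.erase v).filter fun x => p < σ x ∧ σ x < p')
      ((V.erase v).filter fun x => p' < σ x) :=
    Finset.disjoint_filter.mpr fun x _ h h' => lt_asymm h.2 h'
  rw [← card_image_insert_powersetCard hdisj]
  have hins : ∀ {w : α} {P : Finset α}, w ∈ (V.erase v).filter (fun x => p < σ x ∧ σ x < p') →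
      P ∈ ((V.erase v).filter fun x => p' < σ x).powersetCard d →
      insert w P ∈ (V.erase v).powersetCard (d + 2 - 1) := by
    intro w P hwB hP
    rw [Finset.mem_powersetCard] at hP ⊢
    rw [Finset.card_insert_of_notMem fun h => Finset.disjoint_left.mp hdisj hwB (hP.1 h)]
    exact ⟨Finset.insert_subset (Finset.mem_filter.mp hwB).1
      (hP.1.trans (Finset.filter_subset _ _)), by omega⟩
  refine card_le_bcost_add_bcost ?_ ?_
  · intro Q hQ
    obtain ⟨⟨w, P⟩, hwP, rfl⟩ := Finset.mem_image.mp hQ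
    rw [Finset.mem_product] at hwP
    exact hins hwP.1 hwP.2
  intro Q hQF
  obtain ⟨⟨w, P⟩, hwP, rfl⟩ := Finset.mem_image.mp hQF
  rw [Finset.mem_product] at hwP
  obtain ⟨hwB, hPR⟩ := hwP
  dsimp only at hwB hPR ⊢
  obtain ⟨hQ, hQc⟩ := Finset.mem_powersetCard.mp (hins hwB hPR)
  have hPR := (Finset.mem_powersetCard.mp hPR).1
  obtain ⟨hwV, hpw, hwp'⟩ := Finset.mem_filter.mp hwB
  have hwv : w ≠ v := Finset.ne_of_mem_erase hwV
  have hvQ : v ∉ insert w P := fun h => Finset.notMem_erase v V (hQ h)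
  have hS : insert v (insert w P) ∈ V.powersetCard (d + 2) := by
    rw [Finset.mem_powersetCard, Finset.card_insert_of_notMem hvQ]
    exact ⟨Finset.insert_subset hv (hQ.trans (Finset.erase_subset _ _)), by omega⟩
  have hmem : ∀ y ∈ insert v (insert w P), y ≠ v → y ≠ w → p' < σ y := fun y hy hyv hyw =>
    (Finset.mem_filter.mp (hPR ((Finset.mem_insert.mp
      ((Finset.mem_insert.mp hy).resolve_left hyv)).resolve_left hyw))).2
  refine (hw _ hS).one_le_add_of_first_second (hc _ hS).2 (isOrderingOn_update hσ hp hQ)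
    (isOrderingOn_update hσ hp' hQ) (Finset.mem_insert_self v _) ?_ (w := w) (by simp) hwv
    ?_ ?_ ?_
  · intro y _ hyv
    rw [Function.update_of_ne hyv, Function.update_of_ne hyv]
  · intro y hy hyv
    rw [Function.update_self, Function.update_of_ne hyv]
    by_cases hyw : y = w
    · rwa [hyw]
    · exact hpp'.trans (hmem y hy hyv hyw)
  · rwa [Function.update_self, Function.update_of_ne hwv]
  · intro y hy hyv hyw
    rw [Function.update_self, Function.update_of_ne hyv]
    exact hmem y hy hyv hyw

theorem card_between_mul_choose_card_below_le (hc : IsConstraintSystem V (d + 2) c)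
    (hw : WeaklyFragileSystem V (d + 2) c) (hσ : IsOrderingOn V σ) (hv : v ∈ V)
    (hp : ∀ x ∈ V.erase v, σ x ≠ p) (hp' : ∀ x ∈ V.erase v, σ x ≠ p') (hpp' : p < p') :
    ((V.erase v).filter fun x => p < σ x ∧ σ x < p').card *
        ((V.erase v).filter fun x => σ x < p).card.choose d ≤
      bcost V (d + 2) c σ v p + bcost V (d + 2) c σ v p' := by
  have hdisj : Disjoint ((V.erase v).filter fun x => p < σ x ∧ σ x < p')
      ((V.erase v).filter fun x => σ x < p) :=
    Finset.disjoint_filter.mpr fun x _ h h' => lt_asymm h.1 h'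
  rw [← card_image_insert_powersetCard hdisj]
  have hins : ∀ {w : α} {P : Finset α}, w ∈ (V.erase v).filter (fun x => p < σ x ∧ σ x < p') →
      P ∈ ((V.erase v).filter fun x => σ x < p).powersetCard d →
      insert w P ∈ (V.erase v).powersetCard (d + 2 - 1) := by
    intro w P hwB hP
    rw [Finset.mem_powersetCard] at hP ⊢
    rw [Finset.card_insert_of_notMem fun h => Finset.disjoint_left.mp hdisj hwB (hP.1 h)]
    exact ⟨Finset.insert_subset (Finset.mem_filter.mp hwB).1
      (hP.1.trans (Finset.filter_subset _ _)), by omega⟩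
  refine card_le_bcost_add_bcost ?_ ?_
  · intro Q hQ
    obtain ⟨⟨w, P⟩, hwP, rfl⟩ := Finset.mem_image.mp hQ
    rw [Finset.mem_product] at hwP
    exact hins hwP.1 hwP.2
  intro Q hQF
  obtain ⟨⟨w, P⟩, hwP, rfl⟩ := Finset.mem_image.mp hQF
  rw [Finset.mem_product] at hwP
  obtain ⟨hwB, hPL⟩ := hwP
  dsimp only at hwB hPL ⊢
  obtain ⟨hQ, hQc⟩ := Finset.mem_powersetCard.mp (hins hwB hPL)
  have hPL := (Finset.mem_powersetCard.mp hPL).1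
  obtain ⟨hwV, hpw, hwp'⟩ := Finset.mem_filter.mp hwB
  have hwv : w ≠ v := Finset.ne_of_mem_erase hwV
  have hvQ : v ∉ insert w P := fun h => Finset.notMem_erase v V (hQ h)
  have hS : insert v (insert w P) ∈ V.powersetCard (d + 2) := by
    rw [Finset.mem_powersetCard, Finset.card_insert_of_notMem hvQ]
    exact ⟨Finset.insert_subset hv (hQ.trans (Finset.erase_subset _ _)), by omega⟩
  have hmem : ∀ y ∈ insert v (insert w P), y ≠ v → y ≠ w → σ y < p := fun y hy hyv hyw =>
    (Finset.mem_filter.mp (hPL ((Finset.mem_insert.mp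
      ((Finset.mem_insert.mp hy).resolve_left hyv)).resolve_left hyw))).2
  rw [add_comm]
  refine (hw _ hS).one_le_add_of_last_penultimate (hc _ hS).2 (isOrderingOn_update hσ hp' hQ)
    (isOrderingOn_update hσ hp hQ) (Finset.mem_insert_self v _) ?_ (w := w) (by simp) hwv
    ?_ ?_ ?_
  · intro y _ hyv
    rw [Function.update_of_ne hyv, Function.update_of_ne hyv]
  · intro y hy hyv
    rw [Function.update_self, Function.update_of_ne hyv]
    by_cases hyw : y = w
    · rwa [hyw]
    · exact (hmem y hy hyv hyw).trans hpp'
  · rwa [Function.update_self, Function.update_of_ne hwv]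
  · intro y hy hyv hyw
    rw [Function.update_self, Function.update_of_ne hyv]
    exact hmem y hy hyv hyw

end

theorem choose_le_three_pow_mul_choose {d M x : ℕ} (hM : 9 * (d + 1) ^ 2 ≤ M) (hx : M ≤ 3 * x) :
    (M.choose d : ℝ) ≤ 3 ^ (d + 1) * (x.choose d : ℝ) := by
  have hdx : d ≤ x + 1 := by nlinarith
  have hMr : 9 * ((d : ℝ) + 1) ^ 2 ≤ M := by exact_mod_cast hM
  have hxr : (M : ℝ) ≤ 3 * x := by exact_mod_cast hx
  have hd : (0 : ℝ) ≤ d := d.cast_nonneg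
  have hMpos : (0 : ℝ) < M := by nlinarith
  have hdM : 3 * (d : ℝ) / M ≤ 1 := by
    rw [div_le_one hMpos]; nlinarith
  have hbern := one_add_mul_le_pow (show (-2 : ℝ) ≤ -(3 * (d : ℝ) / M) by linarith) d
  have hthird : (1 : ℝ) / 3 ≤ 1 + d * -(3 * (d : ℝ) / M) := by
    have : (d : ℝ) * (3 * d / M) ≤ 2 / 3 := by
      rw [← mul_div_assoc, div_le_iff₀ hMpos]; nlinarith
    linarith
  have hfac : (M : ℝ) * (1 + -(3 * (d : ℝ) / M)) ≤ 3 * ((x + 1 - d : ℕ) : ℝ) := by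
    rw [Nat.cast_sub hdx]
    push_cast
    have : (M : ℝ) * (3 * (d : ℝ) / M) = 3 * d := by field_simp
    linarith
  have hpow := pow_le_pow_left₀ (mul_nonneg hMpos.le (by linarith)) hfac d
  rw [mul_pow, mul_pow] at hpow
  have hMd : (M : ℝ) ^ d ≤ 3 ^ (d + 1) * ((x + 1 - d : ℕ) : ℝ) ^ d := by
    have h := mul_le_mul_of_nonneg_left (hthird.trans hbern) (pow_nonneg hMpos.le d)
    rw [pow_succ]
    linarith
  have hlow : (((x + 1 - d) ^ d : ℕ) : ℝ) ≤ x.descFactorial d :=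
    Nat.cast_le.mpr (Nat.pow_sub_le_descFactorial x d)
  have hup : (M.descFactorial d : ℝ) ≤ ((M ^ d : ℕ) : ℝ) :=
    Nat.cast_le.mpr (Nat.descFactorial_le_pow M d)
  rw [Nat.descFactorial_eq_factorial_mul_choose] at hlow hup
  push_cast at hlow hup
  have hfact : (0 : ℝ) < d.factorial := by exact_mod_cast d.factorial_pos
  refine le_of_mul_le_mul_left ?_ hfact
  calc (d.factorial : ℝ) * M.choose d ≤ M ^ d := hup
    _ ≤ 3 ^ (d + 1) * ((x + 1 - d : ℕ) : ℝ) ^ d := hMd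
    _ ≤ 3 ^ (d + 1) * (d.factorial * x.choose d) := by gcongr
    _ = d.factorial * (3 ^ (d + 1) * x.choose d) := by ring

theorem card_between_div_mul_choose_le {V : Finset α} {d M : ℕ} {c : Finset α → (α → ℝ) → ℕ}
    {σ : α → ℝ} {v : α} {p p' : ℝ} (hV : V.card = M + 2) (hM : 9 * (d + 1) ^ 2 ≤ M)
    (hc : IsConstraintSystem V (d + 2) c)
    (hw : WeaklyFragileSystem V (d + 2) c) (hσ : IsOrderingOn V σ) (hv : v ∈ V)
    (hp : ∀ x ∈ V.erase v, σ x ≠ p) (hp' : ∀ x ∈ V.erase v, σ x ≠ p') (hpp' : p < p') :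
    (((V.erase v).filter fun x => p < σ x ∧ σ x < p').card : ℝ) / (((M : ℝ) + 1) * 3 ^ (d + 1)) *
        ((M + 1).choose (d + 1) : ℝ) ≤
      (bcost V (d + 2) c σ v p : ℝ) + (bcost V (d + 2) c σ v p' : ℝ) := by
  have hbetween := choose_card_between_le hc hw hσ hv hp hp'
  have habove := card_between_mul_choose_card_above_le hc hw hσ hv hp hp' hpp'
  have hbelow := card_between_mul_choose_card_below_le hc hw hσ hv hp hp' hpp'
  have hcard : ((V.erase v).filter fun x => p < σ x ∧ σ x < p').card +
      ((V.erase v).filter fun x => p' < σ x).card +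
      ((V.erase v).filter fun x => σ x < p).card = M + 1 := by
    rw [← Finset.card_union_of_disjoint, ← Finset.card_union_of_disjoint]
    · have : (V.erase v).card = M + 1 := by rw [Finset.card_erase_of_mem hv, hV]; rfl
      rw [← this]
      congr 1
      ext x
      simp only [Finset.mem_union, Finset.mem_filter]
      constructor
      · rintro ((h | h) | h) <;> exact h.1
      · intro hx
        rcases lt_or_gt_of_ne (hp x hx) with h | h
        · exact Or.inr ⟨hx, h⟩
        · rcases lt_or_gt_of_ne (hp' x hx) with h' | h'
          · exact Or.inl (Or.inl ⟨hx, h, h'⟩)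
          · exact Or.inl (Or.inr ⟨hx, h'⟩)
    · rw [← Finset.filter_or]
      exact Finset.disjoint_filter.mpr fun x _ h h' => by
        rcases h with h | h
        · exact lt_asymm h.1 h'
        · exact lt_asymm (hpp'.trans h) h'
    · exact Finset.disjoint_filter.mpr fun x _ h h' => lt_asymm h.2 h'
  rw [← Nat.cast_add]
  set G := bcost V (d + 2) c σ v p + bcost V (d + 2) c σ v p'
  generalize ((V.erase v).filter fun x => p < σ x ∧ σ x < p').card = b at *
  generalize ((V.erase v).filter fun x => p' < σ x).card = r at *
  generalize ((V.erase v).filter fun x => σ x < p).card = l at *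
  rcases Nat.eq_zero_or_pos b with rfl | hb
  · simp
  obtain ⟨x, hx, hxG⟩ : ∃ x, M ≤ 3 * x ∧ b * x.choose d ≤ G * (d + 1) := by
    have hd : ∀ {y}, b * y ≤ G → b * y ≤ G * (d + 1) := fun h =>
      h.trans (Nat.le_mul_of_pos_right G d.succ_pos)
    by_cases hr : M ≤ 3 * r
    · exact ⟨r, hr, hd habove⟩
    by_cases hl : M ≤ 3 * l
    · exact ⟨l, hl, hd hbelow⟩
    obtain ⟨b, rfl⟩ := Nat.exists_eq_add_of_le' hb
    refine ⟨b, by omega, ?_⟩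
    rw [Nat.add_one_mul_choose_eq]
    exact Nat.mul_le_mul_right _ hbetween
  have hchoose := choose_le_three_pow_mul_choose hM hx
  have hxG' : (b : ℝ) * x.choose d ≤ G * (d + 1) := by exact_mod_cast hxG
  have habs : ((M : ℝ) + 1) * M.choose d = (M + 1).choose (d + 1) * (d + 1) := by
    exact_mod_cast Nat.add_one_mul_choose_eq M d
  have hd1 : (0 : ℝ) < d + 1 := by positivity
  have hM1 : (0 : ℝ) < M + 1 := by positivity
  rw [div_mul_eq_mul_div, div_le_iff₀ (by positivity)]
  refine le_of_mul_le_mul_right ?_ hd1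
  calc (b : ℝ) * (M + 1).choose (d + 1) * (d + 1)
      = (M + 1) * (b * M.choose d) := by rw [mul_assoc, ← habs]; ring
    _ ≤ (M + 1) * (b * (3 ^ (d + 1) * x.choose d)) := by gcongr
    _ = (M + 1) * 3 ^ (d + 1) * (b * x.choose d) := by ring
    _ ≤ (M + 1) * 3 ^ (d + 1) * (G * (d + 1)) := by gcongr
    _ = G * ((M + 1) * 3 ^ (d + 1)) * (d + 1) := by ring

end

/-- for fully dense weakly fragile arity-`k` constraint systems on `n`
vertices (`n` sufficiently large), `b(σ,v,p) + b(σ,v,p') ≥ (|B|/((n−1)·3^{k−1}))·C(n−1,k−1)`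
where `B` is the set of vertices (other than `v`) strictly between `p` and `p'` in `σ`. -/
theorem bcost_add_bcost_lower_bound (k : ℕ) (hk : 2 ≤ k) :
    ∃ n₀ : ℕ, ∀ (α : Type u) (V : Finset α) (n : ℕ), V.card = n → n₀ ≤ n →
      ∀ c : Finset α → (α → ℝ) → ℕ, IsConstraintSystem V k c → WeaklyFragileSystem V k c →
        ∀ σ : α → ℝ, IsOrderingOn V σ → ∀ v ∈ V, ∀ p p' : ℝ,
          (∀ x ∈ V.erase v, σ x ≠ p) → (∀ x ∈ V.erase v, σ x ≠ p') →
          ((((V.erase v).filter fun x =>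
                (p < σ x ∧ σ x < p') ∨ (p' < σ x ∧ σ x < p)).card : ℝ) /
              (((n : ℝ) - 1) * 3 ^ (k - 1))) * ((n - 1).choose (k - 1) : ℝ) ≤
            (bcost V k c σ v p : ℝ) + (bcost V k c σ v p' : ℝ) := by
  obtain ⟨d, rfl⟩ := Nat.exists_eq_add_of_le' hk
  refine ⟨9 * (d + 1) ^ 2 + 2, ?_⟩
  intro α V n hV hn c hc hw σ hσ v hv p p' hp hp'
  obtain ⟨M, rfl⟩ := Nat.exists_eq_add_of_le' (show 2 ≤ n by omega)
  have hM : 9 * (d + 1) ^ 2 ≤ M := by omega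
  have hcast : ((M + 2 : ℕ) : ℝ) - 1 = M + 1 := by push_cast; ring
  rw [hcast, show d + 2 - 1 = d + 1 from rfl, show M + 2 - 1 = M + 1 from rfl]
  rcases lt_trichotomy p p' with h | rfl | h
  · convert card_between_div_mul_choose_le hV hM hc hw hσ hv hp hp' h using 5
    refine Finset.filter_congr fun x _ => or_iff_left ?_
    rintro ⟨h1, h2⟩
    linarith
  · have hempty : ((V.erase v).filter fun x =>
        (p < σ x ∧ σ x < p) ∨ (p < σ x ∧ σ x < p)) = ∅ :=
      Finset.filter_false_of_mem fun x _ h => by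
        rcases h with h | h <;> exact lt_asymm h.1 h.2
    rw [hempty, Finset.card_empty, Nat.cast_zero, zero_div, zero_mul]
    positivity
  · rw [add_comm (bcost V (d + 2) c σ v p : ℝ)]
    convert card_between_div_mul_choose_le hV hM hc hw hσ hv hp' hp h using 5
    refine Finset.filter_congr fun x _ => or_iff_right ?_
    rintro ⟨h1, h2⟩
    linarith
end

section
/- Let π be a ranking of V = {1,…,n} and let ε ∈ (0,1] with εn a positive integer. Then the number of π/Round(π)-inversions satisfies d(π, Round(π)) ≤ ε · n(n−1)/2; i.e., at most an ε fraction of all pairs of vertices are inverted between π and Round(π). -/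
open scoped Classical

universe u

/-- Closed form, in terms of the quotient `q` and remainder `r` of `n` by `e`, of the sum of
the residues modulo `e` of the numbers up to `n`. -/
theorem exists_two_mul_sum_mod_eq (e : ℕ) (he : 0 < e) (n : ℕ) :
    ∃ q r : ℕ, r < e ∧ n = e * q + r ∧
      2 * ∑ b ∈ Finset.range (n + 1), b % e + e * q = e * q * e + r * (r + 1) := by
  induction n with
  | zero => exact ⟨0, 0, he, by simp, by simp⟩
  | succ n ih =>
    obtain ⟨q, r, hr, hn, hs⟩ := ih
    rw [Finset.sum_range_succ]
    by_cases h : r + 1 < e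
    · refine ⟨q, r + 1, h, by omega, ?_⟩
      have hm : (n + 1) % e = r + 1 := by
        rw [hn, add_assoc, Nat.mul_add_mod, Nat.mod_eq_of_lt h]
      rw [hm]
      linarith
    · obtain rfl : e = r + 1 := by omega
      have hn' : n + 1 = (r + 1) * (q + 1) := by rw [hn]; ring
      refine ⟨q + 1, 0, he, hn', ?_⟩
      have hm : (n + 1) % (r + 1) = 0 := by rw [hn', Nat.mul_mod_right]
      rw [hm]
      linarith

theorem two_mul_sum_mod_add_le (e n : ℕ) (he : 0 < e) (hen : e ≤ n) :
    2 * ∑ b ∈ Finset.range (n + 1), b % e + e ≤ e * n := by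
  obtain ⟨q, r, hr, hn, hs⟩ := exists_two_mul_sum_mod_eq e he n
  have hq : 1 ≤ q := by
    by_contra! h
    obtain rfl : q = 0 := by omega
    omega
  have hrr : r * (r + 1) ≤ r * e := Nat.mul_le_mul_left r hr
  have hqe : e * 1 ≤ e * q := Nat.mul_le_mul_left e hq
  have hmul : e * n = e * (e * q + r) := congrArg (e * ·) hn
  linarith

/-- The number of pairs `a < b ≤ n` with the same quotient by `e`. -/
theorem card_lt_div_eq_le (e n : ℕ) :
    ((Finset.range (n + 1) ×ˢ Finset.range (n + 1)).filter
      fun p => p.1 < p.2 ∧ p.1 / e = p.2 / e).card ≤ ∑ b ∈ Finset.range (n + 1), b % e := by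
  have hsub : ((Finset.range (n + 1) ×ˢ Finset.range (n + 1)).filter
      fun p => p.1 < p.2 ∧ p.1 / e = p.2 / e) ⊆
      ((Finset.range (n + 1)).sigma fun b => Finset.Ico (b - b % e) b).image
        fun s => (s.2, s.1) := by
    rintro ⟨a, b⟩ h
    simp only [Finset.mem_filter, Finset.mem_product, Finset.mem_range] at h
    obtain ⟨⟨-, hb⟩, hab, hd⟩ := h
    refine Finset.mem_image.2 ⟨⟨b, a⟩, ?_, rfl⟩
    have h1 := Nat.div_add_mod a e
    have h2 := Nat.div_add_mod b e
    rw [hd] at h1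
    simp only [Finset.mem_sigma, Finset.mem_range, Finset.mem_Ico]
    omega
  refine (Finset.card_le_card hsub).trans (Finset.card_image_le.trans ?_)
  rw [Finset.card_sigma]
  refine Finset.sum_le_sum fun b _ => ?_
  rw [Nat.card_Ico]
  omega

/-- Two elements inverted by rounding lie in the same block. -/
theorem floor_eq_of_roundOrd_lt {n e : ℕ} (he : 0 < e) {π : ℕ → ℝ} {u v : ℕ} (hu : u ≤ n)
    (hlt : π u < π v) (hround : roundOrd n e π v < roundOrd n e π u) :
    ⌊π u / (e : ℝ)⌋ = ⌊π v / (e : ℝ)⌋ := by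
  have he1 : (1 : ℝ) ≤ e := by exact_mod_cast he
  refine le_antisymm (Int.floor_mono (by gcongr)) ?_
  by_contra! h
  have hfl : (⌊π u / (e : ℝ)⌋ : ℝ) + 1 ≤ ⌊π v / (e : ℝ)⌋ := by exact_mod_cast h
  have hu1 : (u : ℝ) / ((n : ℝ) + 1) < 1 := by
    rw [div_lt_one (by positivity)]
    exact_mod_cast Nat.lt_succ_of_le hu
  have hv0 : (0 : ℝ) ≤ (v : ℝ) / ((n : ℝ) + 1) := by positivity
  have hmul := mul_le_mul_of_nonneg_left hfl (by linarith : (0 : ℝ) ≤ e)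
  unfold roundOrd at hround
  linarith

/-- for a ranking `π` of `V = {1,…,n}` and `ε ∈ (0,1]` with `εn = e` a
positive integer, `d(π, Round(π)) ≤ ε · n(n−1)/2`. -/
theorem kendall_round_le (n : ℕ) (π : ℕ → ℝ) (hπ : IsRankingOn (Finset.Icc 1 n) π)
    (ε : ℝ) (hε0 : 0 < ε) (hε1 : ε ≤ 1)
    (e : ℕ) (he0 : 0 < e) (he : (e : ℝ) = ε * n) :
    (kendall (Finset.Icc 1 n) π (roundOrd n e π) : ℝ) ≤ ε * n * ((n : ℝ) - 1) / 2 := by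
  have hen : e ≤ n := by
    have : (e : ℝ) ≤ n := by
      rw [he]
      exact mul_le_of_le_one_left (Nat.cast_nonneg n) hε1
    exact_mod_cast this
  have hpos : ∀ u ∈ Finset.Icc 1 n, ⌊π u⌋₊ ≤ n ∧ (⌊π u⌋₊ : ℝ) = π u := by
    intro u hu
    obtain ⟨i, hi, hiu⟩ := hπ.mapsTo hu
    simp only [Nat.card_Icc, add_tsub_cancel_right, Set.mem_Icc] at hi
    simp only at hiu
    rw [← hiu, Nat.floor_natCast]
    exact ⟨hi.2, rfl⟩
  have hinj : ∀ u ∈ Finset.Icc 1 n, ∀ v ∈ Finset.Icc 1 n, ⌊π u⌋₊ = ⌊π v⌋₊ → u = v := by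
    intro u hu v hv huv
    refine hπ.injOn hu hv ?_
    rw [← (hpos u hu).2, ← (hpos v hv).2, huv]
  have hcard : kendall (Finset.Icc 1 n) π (roundOrd n e π) ≤
      ∑ b ∈ Finset.range (n + 1), b % e := by
    refine le_trans ?_ (card_lt_div_eq_le e n)
    refine Finset.card_le_card_of_injOn (fun q => (⌊π q.1⌋₊, ⌊π q.2⌋₊)) ?_ ?_
    · rintro ⟨u, v⟩ h
      obtain ⟨huv, hlt, hround⟩ := Finset.mem_filter.1 (Finset.mem_coe.1 h)
      obtain ⟨hu, hv⟩ := Finset.mem_product.1 huv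
      obtain ⟨hun, hu'⟩ := hpos u hu
      obtain ⟨hvn, hv'⟩ := hpos v hv
      have hfl := floor_eq_of_roundOrd_lt he0 (Finset.mem_Icc.1 hu).2 hlt hround
      refine Finset.mem_coe.2 (Finset.mem_filter.2
        ⟨Finset.mem_product.2 ⟨Finset.mem_range.2 (by simpa using Nat.lt_succ_of_le hun),
          Finset.mem_range.2 (by simpa using Nat.lt_succ_of_le hvn)⟩, ?_, ?_⟩)
      · have : (⌊π u⌋₊ : ℝ) < ⌊π v⌋₊ := by rwa [hu', hv']
        exact_mod_cast this
      · have := congrArg Int.toNat hfl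
        simpa only [Int.floor_toNat, Nat.floor_div_natCast] using this
    · rintro ⟨u, v⟩ h ⟨u', v'⟩ h' heq
      obtain ⟨hu, hv⟩ := Finset.mem_product.1 (Finset.mem_filter.1 (Finset.mem_coe.1 h)).1
      obtain ⟨hu', hv'⟩ := Finset.mem_product.1 (Finset.mem_filter.1 (Finset.mem_coe.1 h')).1
      obtain ⟨h1, h2⟩ := Prod.mk.inj heq
      exact Prod.ext (hinj u hu u' hu' h1) (hinj v hv v' hv' h2)
  have hfinal : 2 * kendall (Finset.Icc 1 n) π (roundOrd n e π) + e ≤ e * n := by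
    have := two_mul_sum_mod_add_le e n he0 hen
    omega
  have hreal : 2 * (kendall (Finset.Icc 1 n) π (roundOrd n e π) : ℝ) + e ≤ e * n := by
    exact_mod_cast hfinal
  rw [← he]
  linarith
end

section
/- Let c be an arity-k constraint system (k ≥ 2) on a vertex set V with |V| = n, let σ and σ' be orderings of the same subset T ⊆ V, let v ∈ V, and let p, p' ∈ ℝ (positions valid for placing v in σ and σ' respectively). Then |b^c(σ, v, p) − b^c(σ', v, p')| ≤ C(n−2, k−2) · X + C(n−3, k−3) · d(σ, σ'), where X is the number of vertices of T that do a (σ, p, σ', p')-crossing, d(σ, σ') is the number of σ/σ'-inversions, and C(n−3, k−3) is taken to be 0 when k = 2. -/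
open scoped Classical

universe u

theorem card_powersetCard_filter_subset_le {α : Type u} (A B : Finset α) (m : ℕ) (hB : B ⊆ A) :
    ((A.powersetCard m).filter fun Q => B ⊆ Q).card ≤ (A.card - B.card).choose (m - B.card) := by
  rw [← Finset.card_sdiff_of_subset hB, ← Finset.card_powersetCard]
  refine Finset.card_le_card_of_injOn (fun Q => Q \ B) ?_ ?_
  · intro Q hQ
    simp only [Finset.coe_filter, Finset.mem_powersetCard, Set.mem_ofPred_eq] at hQ
    obtain ⟨⟨hQA, hQm⟩, hBQ⟩ := hQ
    simp only [Finset.mem_coe, Finset.mem_powersetCard]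
    exact ⟨Finset.sdiff_subset_sdiff hQA subset_rfl, by
      rw [Finset.card_sdiff_of_subset hBQ, hQm]⟩
  · intro Q hQ R hR h
    simp only [Finset.coe_filter, Set.mem_ofPred_eq] at hQ hR
    dsimp only at h
    rw [← Finset.sdiff_union_of_subset hQ.2, ← Finset.sdiff_union_of_subset hR.2, h]

theorem abs_sum_sub_sum_le_card_filter {ι : Type*} (s : Finset ι) (f g : ι → ℕ)
    (P : ι → Prop) [DecidablePred P] (hf : ∀ i ∈ s, f i ≤ 1) (hg : ∀ i ∈ s, g i ≤ 1)
    (h : ∀ i ∈ s, ¬ P i → f i = g i) :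
    |((∑ i ∈ s, f i : ℕ) : ℝ) - ((∑ i ∈ s, g i : ℕ) : ℝ)| ≤ ((s.filter P).card : ℝ) := by
  rw [Finset.card_filter]
  push_cast
  rw [← Finset.sum_sub_distrib]
  refine (Finset.abs_sum_le_sum_abs _ _).trans (Finset.sum_le_sum fun i hi => ?_)
  by_cases hP : P i
  · have hf' : (f i : ℝ) ≤ 1 := by exact_mod_cast hf i hi
    have hg' : (g i : ℝ) ≤ 1 := by exact_mod_cast hg i hi
    have hf0 : (0 : ℝ) ≤ f i := Nat.cast_nonneg _
    have hg0 : (0 : ℝ) ≤ g i := Nat.cast_nonneg _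
    rw [if_pos hP, abs_le]
    constructor <;> linarith
  · simp [hP, h i hi hP]

theorem exists_crossing_or_inversion {α : Type u} {Q : Finset α} {σ σ' : α → ℝ} {v : α}
    {p p' : ℝ} (hv : v ∉ Q) (hσ : IsOrderingOn Q σ) (hσ' : IsOrderingOn Q σ')
    (hp : ∀ x ∈ Q, σ x ≠ p) (hp' : ∀ x ∈ Q, σ' x ≠ p')
    (h : ¬ SameOrderOn (insert v Q) (Function.update σ v p) (Function.update σ' v p')) :
    (∃ x ∈ Q, (σ x < p ∧ p' < σ' x) ∨ (p < σ x ∧ σ' x < p')) ∨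
      ∃ x ∈ Q, ∃ y ∈ Q, σ x < σ y ∧ σ' y < σ' x := by
  contrapose! h
  obtain ⟨hcross, hinv⟩ := h
  have hne : ∀ x ∈ Q, x ≠ v := fun x hx hxv => hv (hxv ▸ hx)
  intro x hx y hy
  rcases Finset.mem_insert.1 hx with hxv | hxQ <;>
    rcases Finset.mem_insert.1 hy with hyv | hyQ
  · simp [hxv, hyv]
  · have h1 := hcross y hyQ
    have h2 := hp y hyQ
    have h3 := hp' y hyQ
    simp only [hxv, Function.update_self, Function.update_of_ne (hne y hyQ)]
    grind
  · have h1 := hcross x hxQ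
    have h2 := hp x hxQ
    have h3 := hp' x hxQ
    simp only [hyv, Function.update_self, Function.update_of_ne (hne x hxQ)]
    grind
  · simp only [Function.update_of_ne (hne x hxQ), Function.update_of_ne (hne y hyQ)]
    by_cases hxy : x = y
    · simp [hxy]
    · have h1 := hinv x hxQ y hyQ
      have h2 := hinv y hyQ x hxQ
      have h3 : σ x ≠ σ y := fun e => hxy (hσ hxQ hyQ e)
      have h4 : σ' x ≠ σ' y := fun e => hxy (hσ' hxQ hyQ e)
      grind

/-- `|b^c(σ,v,p) − b^c(σ',v,p')| ≤ C(n−2,k−2)·X + C(n−3,k−3)·d(σ,σ')`,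
where `X` is the number of vertices of `T` doing a `(σ,p,σ',p')`-crossing and the second
binomial coefficient is taken to be `0` when `k = 2`. -/
theorem bcost_change_bound_crossings {α : Type u} (V : Finset α) (n : ℕ) (hn : V.card = n)
    (k : ℕ) (hk : 2 ≤ k) (c : Finset α → (α → ℝ) → ℕ) (hc : IsConstraintSystem V k c)
    (T : Finset α) (hT : T ⊆ V) (σ σ' : α → ℝ)
    (hσ : IsOrderingOn T σ) (hσ' : IsOrderingOn T σ')
    (v : α) (hv : v ∈ V) (p p' : ℝ)
    (hp : ∀ x ∈ T.erase v, σ x ≠ p) (hp' : ∀ x ∈ T.erase v, σ' x ≠ p') :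
    |(bcost T k c σ v p : ℝ) - (bcost T k c σ' v p' : ℝ)| ≤
      ((n - 2).choose (k - 2) : ℝ) *
          ((T.filter fun x => (σ x < p ∧ p' < σ' x) ∨ (p < σ x ∧ σ' x < p')).card : ℝ)
        + (if k = 2 then 0 else ((n - 3).choose (k - 3) : ℝ)) * (kendall T σ σ' : ℝ) := by
  have hAV : T.erase v ⊆ V.erase v := Finset.erase_subset_erase v hT
  have hAcard : (T.erase v).card ≤ n - 1 := by
    rw [← hn, ← Finset.card_erase_of_mem hv]
    exact Finset.card_le_card hAV
  have hmem : ∀ Q ∈ (T.erase v).powersetCard (k - 1), insert v Q ∈ V.powersetCard k := by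
    intro Q hQ
    obtain ⟨hQA, hQk⟩ := Finset.mem_powersetCard.1 hQ
    have hvQ : v ∉ Q := fun h => Finset.notMem_erase v T (hQA h)
    rw [Finset.mem_powersetCard, Finset.card_insert_of_notMem hvQ]
    exact ⟨Finset.insert_subset hv ((hQA.trans (Finset.erase_subset _ _)).trans hT), by omega⟩
  refine (abs_sum_sub_sum_le_card_filter ((T.erase v).powersetCard (k - 1)) _ _
    (fun Q => ¬ SameOrderOn (insert v Q) (Function.update σ v p) (Function.update σ' v p'))
    (fun Q hQ => (hc _ (hmem Q hQ)).1 _) (fun Q hQ => (hc _ (hmem Q hQ)).1 _)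
    (fun Q hQ h => (hc _ (hmem Q hQ)).2 _ _ (not_not.1 h))).trans ?_
  set X := T.filter fun x => (σ x < p ∧ p' < σ' x) ∨ (p < σ x ∧ σ' x < p')
  set D := (T ×ˢ T).filter fun q => σ q.1 < σ q.2 ∧ σ' q.2 < σ' q.1
  have hcover : ((T.erase v).powersetCard (k - 1)).filter (fun Q =>
        ¬ SameOrderOn (insert v Q) (Function.update σ v p) (Function.update σ' v p')) ⊆
      X.biUnion (fun x => ((T.erase v).powersetCard (k - 1)).filter fun Q => {x} ⊆ Q) ∪
      D.biUnion (fun q => ((T.erase v).powersetCard (k - 1)).filter fun Q => {q.1, q.2} ⊆ Q) := by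
    intro Q hQ
    obtain ⟨hQ, hne⟩ := Finset.mem_filter.1 hQ
    have hQA := (Finset.mem_powersetCard.1 hQ).1
    have hQT := hQA.trans (Finset.erase_subset v T)
    have hvQ : v ∉ Q := fun h => Finset.notMem_erase v T (hQA h)
    rcases exists_crossing_or_inversion hvQ (hσ.mono (by exact_mod_cast hQT))
      (hσ'.mono (by exact_mod_cast hQT)) (fun x hx => hp x (hQA hx))
      (fun x hx => hp' x (hQA hx)) hne with ⟨x, hx, hcr⟩ | ⟨x, hx, y, hy, hinv⟩
    · refine Finset.mem_union_left _ (Finset.mem_biUnion.2 ⟨x, ?_, ?_⟩)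
      · exact Finset.mem_filter.2 ⟨hQT hx, hcr⟩
      · exact Finset.mem_filter.2 ⟨hQ, Finset.singleton_subset_iff.2 hx⟩
    · refine Finset.mem_union_right _ (Finset.mem_biUnion.2 ⟨(x, y), ?_, ?_⟩)
      · exact Finset.mem_filter.2 ⟨Finset.mk_mem_product (hQT hx) (hQT hy), hinv⟩
      · exact Finset.mem_filter.2 ⟨hQ, Finset.insert_subset hx (Finset.singleton_subset_iff.2 hy)⟩
  have hcontain : ∀ B : Finset α,
      (((T.erase v).powersetCard (k - 1)).filter fun Q => B ⊆ Q).card ≤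
        (n - 1 - B.card).choose (k - 1 - B.card) := by
    intro B
    by_cases hB : B ⊆ T.erase v
    · exact (card_powersetCard_filter_subset_le _ B _ hB).trans
        (Nat.choose_le_choose _ (Nat.sub_le_sub_right hAcard _))
    · rw [Finset.filter_false_of_mem]
      · simp
      · exact fun Q hQ hBQ => hB (hBQ.trans (Finset.mem_powersetCard.1 hQ).1)
  have hcross : ∀ x ∈ X,
      (((T.erase v).powersetCard (k - 1)).filter fun Q => {x} ⊆ Q).card ≤
        (n - 2).choose (k - 2) := by
    intro x _
    simpa [Nat.sub_sub] using hcontain {x}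
  have hinv : ∀ q ∈ D,
      (((T.erase v).powersetCard (k - 1)).filter fun Q => {q.1, q.2} ⊆ Q).card ≤
        if k = 2 then 0 else (n - 3).choose (k - 3) := by
    intro q hq
    have hq12 : q.1 ≠ q.2 := fun e => by
      have := (Finset.mem_filter.1 hq).2.1
      rw [e] at this
      exact lt_irrefl _ this
    have hcard : ({q.1, q.2} : Finset α).card = 2 := Finset.card_pair hq12
    split_ifs with hk2
    · rw [Finset.filter_false_of_mem]
      · simp
      · intro Q hQ hBQ
        have h1 := Finset.card_le_card hBQ
        have h2 := (Finset.mem_powersetCard.1 hQ).2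
        omega
    · have h := hcontain {q.1, q.2}
      rwa [hcard, Nat.sub_sub, Nat.sub_sub] at h
  have hbound := (Finset.card_le_card hcover).trans <| (Finset.card_union_le _ _).trans <|
    add_le_add (Finset.card_biUnion_le_card_mul X _ _ hcross)
      (Finset.card_biUnion_le_card_mul D _ _ hinv)
  have hkd : kendall T σ σ' = D.card := rfl
  rw [hkd, mul_comm ((n - 2).choose (k - 2) : ℝ), mul_comm (ite _ _ _)]
  exact_mod_cast hbound
end

section
/- For every k ≥ 2 there exists n₀ such that the following holds for all n ≥ n₀. Let c be an arity-k constraint system on a vertex set V with |V| = n, let σ and σ' be orderings of the same subset T ⊆ V, let v ∈ V, and let p, p' ∈ ℝ (positions valid for placing v in σ and σ' respectively). Then |b^c(σ, v, p) − b^c(σ', v, p')| ≤ C(n−2, k−2) · ( |F| + k·√(d(σ, σ')) ), where F = |{u ∈ T : σ'(u) > p'}| − |{u ∈ T : σ(u) > p}| is the net flow and d(σ, σ') is the number of σ/σ'-inversions. -/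
open scoped Classical

universe u

section

variable {α : Type u}

/-- The members of `T` that lie on different sides of `p` under `σ` and of `p'` under `σ'`. -/
noncomputable def crossers (T : Finset α) (σ σ' : α → ℝ) (p p' : ℝ) : Finset α :=
  T.filter fun x => ¬(p < σ x ↔ p' < σ' x)

lemma card_powersetCard_filter_superset_le (S A : Finset α) (j : ℕ) :
    ((S.powersetCard (A.card + j)).filter fun Q => A ⊆ Q).card ≤ (S.card - A.card).choose j := by
  by_cases hA : A ⊆ S
  · rw [← Finset.card_sdiff_of_subset hA, ← Finset.card_powersetCard]
    refine Finset.card_le_card_of_injOn (fun Q => Q \ A) ?_ ?_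
    · intro Q hQ
      simp only [Finset.coe_filter, Set.mem_ofPred_eq, Finset.mem_powersetCard] at hQ
      simp only [Finset.mem_coe, Finset.mem_powersetCard]
      refine ⟨Finset.sdiff_subset_sdiff hQ.1.1 le_rfl, ?_⟩
      rw [Finset.card_sdiff_of_subset hQ.2, hQ.1.2]
      omega
    · intro Q hQ R hR h
      simp only [Finset.coe_filter, Set.mem_ofPred_eq] at hQ hR
      rw [← Finset.sdiff_union_of_subset hQ.2, ← Finset.sdiff_union_of_subset hR.2]
      exact congrArg (· ∪ A) h
  · rw [Finset.filter_false_of_mem, Finset.card_empty]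
    · exact Nat.zero_le _
    · intro Q hQ h
      exact hA (h.trans (Finset.mem_powersetCard.1 hQ).1)

lemma exists_pair_superset_bound {k n : ℕ} (hk : 2 ≤ k) (hn : 3 ≤ n) (S : Finset α)
    (hS : S.card ≤ n - 1) :
    ∃ P : ℕ, (∀ x y : α, x ≠ y →
      ((S.powersetCard (k - 1)).filter fun Q => {x, y} ⊆ Q).card ≤ P) ∧
      (n - 2) * P ≤ (k - 2) * (n - 2).choose (k - 2) := by
  obtain rfl | ⟨j, rfl⟩ : k = 2 ∨ ∃ j, k = j + 3 := by
    rcases hk.eq_or_lt with h | h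
    · exact Or.inl h.symm
    · exact Or.inr ⟨k - 3, by omega⟩
  · refine ⟨0, fun x y hxy => ?_, by simp⟩
    rw [Finset.filter_false_of_mem, Finset.card_empty]
    intro Q hQ h
    have h1 := Finset.card_le_card h
    rw [Finset.card_pair hxy, (Finset.mem_powersetCard.1 hQ).2] at h1
    omega
  · obtain ⟨m, rfl⟩ : ∃ m, n = m + 3 := ⟨n - 3, by omega⟩
    refine ⟨m.choose j, fun x y hxy => ?_, ?_⟩
    · have h := card_powersetCard_filter_superset_le S {x, y} j
      rw [Finset.card_pair hxy, show 2 + j = j + 3 - 1 by omega] at h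
      exact h.trans (Nat.choose_le_choose _ (by omega))
    · have h := Nat.add_one_mul_choose_eq m j
      rw [show m + 3 - 2 = m + 1 by omega, show j + 3 - 2 = j + 1 by omega, h, mul_comm]

lemma kendall_le_sq (S : Finset α) (σ σ' : α → ℝ) : kendall S σ σ' ≤ (S.card - 1) ^ 2 := by
  set I := (S ×ˢ S).filter fun q => σ q.1 < σ q.2 ∧ σ' q.2 < σ' q.1 with hI
  have hdisj : Disjoint I (I.image Prod.swap) := by
    rw [Finset.disjoint_left]
    rintro q hq hq'
    obtain ⟨r, hr, rfl⟩ := Finset.mem_image.1 hq'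
    exact lt_asymm (Finset.mem_filter.1 hq).2.1 (Finset.mem_filter.1 hr).2.1
  have hsub : I ∪ I.image Prod.swap ⊆ S.offDiag := by
    intro q hq
    rcases Finset.mem_union.1 hq with h | h
    · obtain ⟨h1, h2, -⟩ := Finset.mem_filter.1 h
      rw [Finset.mem_product] at h1
      exact Finset.mem_offDiag.2 ⟨h1.1, h1.2, fun h => h2.ne (congrArg σ h)⟩
    · obtain ⟨r, hr, rfl⟩ := Finset.mem_image.1 h
      obtain ⟨h1, h2, -⟩ := Finset.mem_filter.1 hr
      rw [Finset.mem_product] at h1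
      exact Finset.mem_offDiag.2 ⟨h1.2, h1.1, fun h => h2.ne' (congrArg σ h)⟩
  have h := Finset.card_le_card hsub
  rw [Finset.card_union_of_disjoint hdisj, Finset.card_image_of_injective _ Prod.swap_injective,
    Finset.offDiag_card] at h
  change I.card ≤ _
  generalize S.card = m at h
  rcases m with _ | _ | m
  · exact (by omega : I.card = 0).le.trans (Nat.zero_le _)
  · exact (by omega : I.card = 0).le.trans (Nat.zero_le _)
  · have : (m + 1 + 1) * (m + 1 + 1) - (m + 1 + 1) = (m + 2) * (m + 1) := by
      rw [Nat.sub_eq_iff_eq_add (Nat.le_mul_self _)]; ring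
    rw [this] at h
    simp only [Nat.add_sub_cancel]
    nlinarith

lemma kendall_mono {S T : Finset α} (h : S ⊆ T) (σ σ' : α → ℝ) :
    kendall S σ σ' ≤ kendall T σ σ' :=
  Finset.card_le_card (Finset.filter_subset_filter _ (Finset.product_subset_product h h))

lemma card_crossers_le (T : Finset α) (σ σ' : α → ℝ) (p p' : ℝ) :
    ((crossers T σ σ' p p').card : ℝ) ≤
      |((T.filter fun x => p' < σ' x).card : ℝ) - ((T.filter fun x => p < σ x).card : ℝ)| +
        2 * Real.sqrt (kendall T σ σ') := by
  set L := T.filter fun x => p < σ x ∧ ¬p' < σ' x with hL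
  set R := T.filter fun x => ¬p < σ x ∧ p' < σ' x with hR
  set B := T.filter fun x => p < σ x ∧ p' < σ' x with hB
  have hprod : R.card * L.card ≤ kendall T σ σ' := by
    rw [← Finset.card_product]
    refine Finset.card_le_card fun q hq => ?_
    obtain ⟨hr, hl⟩ := Finset.mem_product.1 hq
    obtain ⟨hr0, hr1, hr2⟩ := Finset.mem_filter.1 hr
    obtain ⟨hl0, hl1, hl2⟩ := Finset.mem_filter.1 hl
    exact Finset.mem_filter.2 ⟨Finset.mem_product.2 ⟨hr0, hl0⟩,
      (not_lt.1 hr1).trans_lt hl1, (not_lt.1 hl2).trans_lt hr2⟩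
  have hX : (crossers T σ σ' p p').card ≤ L.card + R.card := by
    refine (Finset.card_le_card fun x hx => ?_).trans (Finset.card_union_le _ _)
    simp only [crossers, hL, hR, Finset.mem_union, Finset.mem_filter] at hx ⊢
    tauto
  have hσ : (T.filter fun x => p < σ x).card = B.card + L.card := by
    rw [← Finset.card_filter_add_card_filter_not (s := T.filter fun x => p < σ x)
      (fun x => p' < σ' x), Finset.filter_filter, Finset.filter_filter]
  have hσ' : (T.filter fun x => p' < σ' x).card = B.card + R.card := by
    rw [← Finset.card_filter_add_card_filter_not (s := T.filter fun x => p' < σ' x)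
      (fun x => p < σ x), Finset.filter_filter, Finset.filter_filter]
    simp only [hB, hR, and_comm]
  rw [hσ, hσ']
  have hX' : ((crossers T σ σ' p p').card : ℝ) ≤ L.card + R.card := by exact_mod_cast hX
  have hprod' : (R.card : ℝ) * L.card ≤ kendall T σ σ' := by exact_mod_cast hprod
  push_cast
  rcases le_total (L.card : ℝ) R.card with h | h
  · have h1 : (L.card : ℝ) ≤ Real.sqrt (kendall T σ σ') :=
      Real.le_sqrt_of_sq_le (by nlinarith [Nat.cast_nonneg (α := ℝ) L.card])
    linarith [le_abs_self ((B.card : ℝ) + R.card - (B.card + L.card))]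
  · have h1 : (R.card : ℝ) ≤ Real.sqrt (kendall T σ σ') :=
      Real.le_sqrt_of_sq_le (by nlinarith [Nat.cast_nonneg (α := ℝ) R.card])
    linarith [neg_abs_le ((B.card : ℝ) + R.card - (B.card + L.card))]

lemma sameOrderOn_update_insert {Q : Finset α} {v : α} (hv : v ∉ Q) {σ σ' : α → ℝ} {p p' : ℝ}
    (hσ : Set.InjOn σ ↑Q) (hσ' : Set.InjOn σ' ↑Q) (hp : ∀ x ∈ Q, σ x ≠ p)
    (hp' : ∀ x ∈ Q, σ' x ≠ p') (hcross : ∀ x ∈ Q, p < σ x ↔ p' < σ' x)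
    (hinv : ∀ x ∈ Q, ∀ y ∈ Q, ¬(σ x < σ y ∧ σ' y < σ' x)) :
    SameOrderOn (insert v Q) (Function.update σ v p) (Function.update σ' v p') := by
  have hcross' : ∀ x ∈ Q, σ x < p ↔ σ' x < p' := fun x hx => by
    rw [← not_iff_not, not_lt, not_lt, (hp x hx).symm.le_iff_lt, (hp' x hx).symm.le_iff_lt]
    exact hcross x hx
  have hne : ∀ x ∈ Q, x ≠ v := fun x hx h => hv (h ▸ hx)
  intro x hx y hy
  rcases Finset.mem_insert.1 hx with rfl | hxQ <;> rcases Finset.mem_insert.1 hy with rfl | hyQ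
  · simp
  · simpa [hne y hyQ] using hcross y hyQ
  · simpa [hne x hxQ] using hcross' x hxQ
  · simp only [Function.update_of_ne (hne x hxQ), Function.update_of_ne (hne y hyQ)]
    constructor
    · intro h
      refine lt_of_le_of_ne (not_lt.1 fun h' => hinv x hxQ y hyQ ⟨h, h'⟩) fun h' => ?_
      exact h.ne (congrArg σ (hσ' hxQ hyQ h'))
    · intro h
      refine lt_of_le_of_ne (not_lt.1 fun h' => hinv y hyQ x hxQ ⟨h', h⟩) fun h' => ?_
      exact h.ne (congrArg σ' (hσ hxQ hyQ h'))

lemma abs_sum_sub_sum_le_card {ι : Type*} (s t : Finset ι) (f g : ι → ℕ)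
    (hf : ∀ i ∈ s, f i ≤ 1) (hg : ∀ i ∈ s, g i ≤ 1) (h : ∀ i ∈ s, f i ≠ g i → i ∈ t) :
    |((∑ i ∈ s, f i : ℕ) : ℝ) - ((∑ i ∈ s, g i : ℕ) : ℝ)| ≤ t.card := by
  push_cast
  rw [← Finset.sum_sub_distrib]
  calc |∑ i ∈ s, ((f i : ℝ) - g i)| ≤ ∑ i ∈ s, |(f i : ℝ) - g i| := Finset.abs_sum_le_sum_abs _ _
    _ ≤ ∑ i ∈ s, if f i ≠ g i then (1 : ℝ) else 0 := by
      refine Finset.sum_le_sum fun i hi => ?_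
      split_ifs with hne
      · have h1 : (f i : ℝ) ≤ 1 := by exact_mod_cast hf i hi
        have h2 : (g i : ℝ) ≤ 1 := by exact_mod_cast hg i hi
        rw [abs_le]
        constructor <;> linarith [Nat.cast_nonneg (α := ℝ) (f i), Nat.cast_nonneg (α := ℝ) (g i)]
      · simp [not_not.1 hne]
    _ = ((s.filter fun i => f i ≠ g i).card : ℝ) := by rw [Finset.sum_boole]
    _ ≤ t.card := by
      exact_mod_cast Finset.card_le_card fun i hi =>
        h i (Finset.mem_filter.1 hi).1 (Finset.mem_filter.1 hi).2

end

/-- for `n` sufficiently large (given `k`),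
`|b^c(σ,v,p) − b^c(σ',v,p')| ≤ C(n−2,k−2)·(|F| + k·√(d(σ,σ')))` where
`F = #{u ∈ T : σ'(u) > p'} − #{u ∈ T : σ(u) > p}` is the net flow. -/
theorem bcost_change_bound_netflow (k : ℕ) (hk : 2 ≤ k) :
    ∃ n₀ : ℕ, ∀ (α : Type u) (V : Finset α) (n : ℕ), V.card = n → n₀ ≤ n →
      ∀ c : Finset α → (α → ℝ) → ℕ, IsConstraintSystem V k c →
      ∀ T : Finset α, T ⊆ V → ∀ σ σ' : α → ℝ, IsOrderingOn T σ → IsOrderingOn T σ' →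
      ∀ v : α, v ∈ V → ∀ p p' : ℝ,
        (∀ x ∈ T.erase v, σ x ≠ p) → (∀ x ∈ T.erase v, σ' x ≠ p') →
        |(bcost T k c σ v p : ℝ) - (bcost T k c σ' v p' : ℝ)| ≤
          ((n - 2).choose (k - 2) : ℝ) *
            (|((T.filter fun x => p' < σ' x).card : ℝ) -
                ((T.filter fun x => p < σ x).card : ℝ)| +
              (k : ℝ) * Real.sqrt (kendall T σ σ')) := by
  refine ⟨3, fun α V n hVn hn c hc T hTV σ σ' hσ hσ' v hv p p' hp hp' => ?_⟩
  set S := T.erase v with hS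
  have hST : S ⊆ T := Finset.erase_subset v T
  have hSV : S.card ≤ n - 1 := by
    rw [← hVn, ← Finset.card_erase_of_mem hv]
    exact Finset.card_le_card (Finset.erase_subset_erase v hTV)
  obtain ⟨P, hP, hPn⟩ := exists_pair_superset_bound hk hn S hSV
  set X := crossers S σ σ' p p' with hX
  set I := (S ×ˢ S).filter fun q => σ q.1 < σ q.2 ∧ σ' q.2 < σ' q.1 with hI
  set D := S.powersetCard (k - 1) with hD
  set B := (X.biUnion fun x => D.filter fun Q => {x} ⊆ Q) ∪
    (I.biUnion fun q => D.filter fun Q => {q.1, q.2} ⊆ Q) with hB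
  have hBcard : B.card ≤ X.card * (n - 2).choose (k - 2) + kendall S σ σ' * P := by
    refine (Finset.card_union_le _ _).trans (add_le_add ?_ ?_)
    · refine Finset.card_biUnion_le_card_mul _ _ _ fun x _ => ?_
      have h := card_powersetCard_filter_superset_le S {x} (k - 2)
      rw [Finset.card_singleton, show 1 + (k - 2) = k - 1 by omega] at h
      exact h.trans (Nat.choose_le_choose _ (by omega))
    · refine Finset.card_biUnion_le_card_mul _ _ _ fun q hq => hP _ _ fun h => ?_
      exact (Finset.mem_filter.1 hq).2.1.ne (congrArg σ h)
  have hmem : ∀ Q ∈ D, insert v Q ∈ V.powersetCard k := by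
    intro Q hQ
    obtain ⟨hQS, hQk⟩ := Finset.mem_powersetCard.1 hQ
    have hvQ : v ∉ Q := fun h => Finset.notMem_erase v T (hQS h)
    refine Finset.mem_powersetCard.2
      ⟨Finset.insert_subset hv (hQS.trans (hST.trans hTV)), ?_⟩
    rw [Finset.card_insert_of_notMem hvQ, hQk]
    omega
  have hdiff : |(bcost T k c σ v p : ℝ) - (bcost T k c σ' v p' : ℝ)| ≤ B.card := by
    refine abs_sum_sub_sum_le_card D B _ _ (fun Q hQ => (hc _ (hmem Q hQ)).1 _)
      (fun Q hQ => (hc _ (hmem Q hQ)).1 _) fun Q hQ hne => ?_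
    by_contra hQB
    have hQS := (Finset.mem_powersetCard.1 hQ).1
    simp only [hB, Finset.mem_union, Finset.mem_biUnion, Finset.mem_filter, not_or, not_exists,
      not_and] at hQB
    refine hne ((hc _ (hmem Q hQ)).2 _ _ (sameOrderOn_update_insert
      (fun h => Finset.notMem_erase v T (hQS h))
      (hσ.mono (Finset.coe_subset.2 (hQS.trans hST)))
      (hσ'.mono (Finset.coe_subset.2 (hQS.trans hST)))
      (fun x hx => hp x (hQS hx)) (fun x hx => hp' x (hQS hx)) (fun x hx => ?_)
      fun x hx y hy h => ?_))
    · by_contra h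
      exact hQB.1 x (Finset.mem_filter.2 ⟨hQS hx, h⟩) hQ (Finset.singleton_subset_iff.2 hx)
    · exact hQB.2 (x, y) (Finset.mem_filter.2 ⟨Finset.mem_product.2 ⟨hQS hx, hQS hy⟩, h⟩) hQ
        (Finset.insert_subset hx (Finset.singleton_subset_iff.2 hy))
  set s := Real.sqrt (kendall T σ σ') with hs
  have hXle : (X.card : ℝ) ≤ (crossers T σ σ' p p').card := by
    exact_mod_cast Finset.card_le_card (Finset.filter_subset_filter _ hST)
  have hflow := hXle.trans (card_crossers_le T σ σ' p p')
  have hken : (kendall S σ σ' : ℝ) ≤ ((n - 2 : ℕ) : ℝ) * s := by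
    have h1 : (kendall S σ σ' : ℝ) ≤ ((n - 2 : ℕ) : ℝ) ^ 2 := by
      exact_mod_cast (kendall_le_sq S σ σ').trans (Nat.pow_le_pow_left (by omega) 2)
    have h2 : Real.sqrt (kendall S σ σ') ≤ ((n - 2 : ℕ) : ℝ) :=
      Real.sqrt_le_iff.2 ⟨Nat.cast_nonneg _, h1⟩
    have h3 : Real.sqrt (kendall S σ σ') ≤ s :=
      Real.sqrt_le_sqrt (by exact_mod_cast kendall_mono hST σ σ')
    rw [← Real.mul_self_sqrt (Nat.cast_nonneg (α := ℝ) (kendall S σ σ'))]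
    exact mul_le_mul h2 h3 (Real.sqrt_nonneg _) (Nat.cast_nonneg _)
  have hPn' : ((n - 2 : ℕ) : ℝ) * P ≤ ((k : ℝ) - 2) * ((n - 2).choose (k - 2) : ℝ) := by
    rw [← Nat.cast_two (R := ℝ), ← Nat.cast_sub hk]
    exact_mod_cast hPn
  set N : ℝ := ((n - 2).choose (k - 2) : ℝ) with hN
  set F := |((T.filter fun x => p' < σ' x).card : ℝ) - ((T.filter fun x => p < σ x).card : ℝ)|
  calc _ ≤ (B.card : ℝ) := hdiff
    _ ≤ (X.card : ℝ) * N + kendall S σ σ' * P := by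
      rw [hN]
      exact_mod_cast hBcard
    _ ≤ (F + 2 * s) * N + ((n - 2 : ℕ) : ℝ) * s * P :=
      add_le_add (mul_le_mul_of_nonneg_right hflow (Nat.cast_nonneg _))
        (mul_le_mul_of_nonneg_right hken (Nat.cast_nonneg _))
    _ = (F + 2 * s) * N + (((n - 2 : ℕ) : ℝ) * P) * s := by ring
    _ ≤ (F + 2 * s) * N + (((k : ℝ) - 2) * N) * s := by
      have := mul_le_mul_of_nonneg_right hPn' (Real.sqrt_nonneg (kendall T σ σ'))
      linarith
    _ = N * (F + k * s) := by ring
end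

section
/- Let U be a finite set, w a nonnegative weight function on ordered pairs of distinct elements of U, π and π' rankings of U, v ∈ U, and p ∈ ℝ ∖ ℤ. Then |b^w(π, v, p) − b^w(π', v, p)| ≤ 2 · (max_{r ≠ s} w_{rs}) · √(d(π, π')). -/
open scoped Classical

universe u

/-- The number of vertices placed below `p` is the same in any two rankings. -/
theorem IsRankingOn.card_filter_lt_eq {α : Type u} {U : Finset α} {π π' : α → ℝ}
    (hπ : IsRankingOn U π) (hπ' : IsRankingOn U π') (p : ℝ) :
    (U.filter fun x => π x < p).card = (U.filter fun x => π' x < p).card := by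
  have himage : U.image π = U.image π' := by
    apply Finset.coe_injective
    rw [Finset.coe_image, Finset.coe_image, hπ.image_eq, hπ'.image_eq]
  have hcard : ∀ σ : α → ℝ, Set.InjOn σ ↑U →
      (U.filter fun x => σ x < p).card = ((U.image σ).filter (· < p)).card := by
    intro σ hσ
    rw [Finset.filter_image, Finset.card_image_of_injOn]
    exact hσ.mono (Finset.coe_subset.2 (Finset.filter_subset _ _))
  rw [hcard π hπ.injOn, hcard π' hπ'.injOn, himage]

/-- A ranking never places a vertex at a non-integer position. -/
theorem IsRankingOn.ne_of_forall_ne_int {α : Type u} {U : Finset α} {π : α → ℝ}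
    (hπ : IsRankingOn U π) {p : ℝ} (hp : ∀ m : ℤ, p ≠ (m : ℝ)) {x : α} (hx : x ∈ U) :
    π x ≠ p := by
  obtain ⟨i, -, hi⟩ := hπ.mapsTo hx
  intro h
  exact hp i (by rw [← h, ← hi]; simp)

/-- Two vertices that cross the position `p` in opposite directions form an inversion. -/
theorem card_crossing_mul_card_crossing_le_kendall {α : Type u} (U : Finset α)
    (π π' : α → ℝ) (p : ℝ) :
    (U.filter fun x => π x < p ∧ p < π' x).card * (U.filter fun x => π' x < p ∧ p < π x).card ≤
      kendall U π π' := by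
  rw [← Finset.card_product, kendall]
  apply Finset.card_le_card
  rintro ⟨a, b⟩ hab
  simp only [Finset.mem_product, Finset.mem_filter] at hab ⊢
  obtain ⟨⟨ha, ha1, ha2⟩, hb, hb1, hb2⟩ := hab
  exact ⟨⟨ha, hb⟩, ha1.trans hb2, hb1.trans ha2⟩

/-- As many vertices cross a non-integer position upwards as downwards. -/
theorem IsRankingOn.card_crossing_eq {α : Type u} {U : Finset α} {π π' : α → ℝ}
    (hπ : IsRankingOn U π) (hπ' : IsRankingOn U π') {p : ℝ} (hp : ∀ m : ℤ, p ≠ (m : ℝ)) :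
    (U.filter fun x => π x < p ∧ p < π' x).card =
      (U.filter fun x => π' x < p ∧ p < π x).card := by
  have hsdiff : ∀ σ τ : α → ℝ, IsRankingOn U τ →
      (U.filter fun x => σ x < p ∧ p < τ x) =
        (U.filter fun x => σ x < p) \ (U.filter fun x => τ x < p) := by
    intro σ τ hτ
    ext x
    simp only [Finset.mem_filter, Finset.mem_sdiff, not_and, not_lt]
    constructor
    · rintro ⟨hx, h1, h2⟩
      exact ⟨⟨hx, h1⟩, fun _ => h2.le⟩
    · rintro ⟨⟨hx, h1⟩, h2⟩
      exact ⟨hx, h1, lt_of_le_of_ne (h2 hx) (hτ.ne_of_forall_ne_int hp hx).symm⟩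
  rw [hsdiff π π' hπ', hsdiff π' π hπ]
  exact Finset.card_sdiff_comm (hπ.card_filter_lt_eq hπ' p)

/-- Every weight is at most the supremum of the weights. -/
theorem weight_le_sSup {α : Type u} {U : Finset α} (w : α → α → ℝ) {r s : α}
    (hr : r ∈ U) (hs : s ∈ U) (hrs : r ≠ s) :
    w r s ≤ sSup {x : ℝ | ∃ r ∈ U, ∃ s ∈ U, r ≠ s ∧ x = w r s} := by
  refine le_csSup (Set.Finite.bddAbove ?_) ⟨r, hr, s, hs, hrs, rfl⟩
  refine ((U ×ˢ U).image fun q => w q.1 q.2).finite_toSet.subset ?_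
  rintro x ⟨a, ha, b, hb, -, rfl⟩
  exact Finset.mem_coe.2 (Finset.mem_image.2 ⟨(a, b), Finset.mem_product.2 ⟨ha, hb⟩, rfl⟩)

/-- The change of `bW` is at most the largest weight times the number of vertices
crossing `p`. -/
theorem abs_bW_sub_bW_le {α : Type u} {U : Finset α} {w : α → α → ℝ}
    (hw : ∀ r ∈ U, ∀ s ∈ U, r ≠ s → 0 ≤ w r s) {M : ℝ} (hM : 0 ≤ M)
    (hwM : ∀ r ∈ U, ∀ s ∈ U, r ≠ s → w r s ≤ M) {π π' : α → ℝ} {v : α} (hv : v ∈ U) {p : ℝ}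
    (hπ : ∀ x ∈ U, π x ≠ p) (hπ' : ∀ x ∈ U, π' x ≠ p) :
    |bW U w π v p - bW U w π' v p| ≤
      M * ((U.filter fun x => π x < p ∧ p < π' x).card +
        (U.filter fun x => π' x < p ∧ p < π x).card) := by
  have hterm : ∀ x ∈ U.erase v,
      |(if p < π x then w x v else if π x < p then w v x else 0) -
        (if p < π' x then w x v else if π' x < p then w v x else 0)| ≤
      (if π x < p ∧ p < π' x then M else 0) + (if π' x < p ∧ p < π x then M else 0) := by
    intro x hx
    obtain ⟨hxv, hxU⟩ := Finset.mem_erase.1 hx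
    have h1 := hw x hxU v hv hxv
    have h2 := hw v hv x hxU hxv.symm
    have h3 := hwM x hxU v hv hxv
    have h4 := hwM v hv x hxU hxv.symm
    rcases lt_or_gt_of_ne (hπ x hxU) with h | h <;>
      rcases lt_or_gt_of_ne (hπ' x hxU) with h' | h' <;>
      simp only [h, h', h.not_gt, h'.not_gt, if_true, if_false, and_true, and_false,
        sub_self, abs_zero, add_zero, zero_add, le_refl] <;>
      exact abs_le.2 ⟨by linarith, by linarith⟩
  calc |bW U w π v p - bW U w π' v p|
      ≤ ∑ x ∈ U.erase v, ((if π x < p ∧ p < π' x then M else 0) +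
          (if π' x < p ∧ p < π x then M else 0)) := by
        rw [bW, bW, ← Finset.sum_sub_distrib]
        exact (Finset.abs_sum_le_sum_abs _ _).trans (Finset.sum_le_sum hterm)
    _ ≤ ∑ x ∈ U, ((if π x < p ∧ p < π' x then M else 0) +
          (if π' x < p ∧ p < π x then M else 0)) := by
        refine Finset.sum_le_sum_of_subset_of_nonneg (Finset.erase_subset _ _) ?_
        intro x _ _
        positivity
    _ = _ := by
        rw [Finset.sum_add_distrib, ← Finset.sum_filter, ← Finset.sum_filter,
          Finset.sum_const, Finset.sum_const, nsmul_eq_mul, nsmul_eq_mul]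
        ring

/-- for a nonnegative FAS instance `w` on `U`, rankings `π, π'` of `U`,
`v ∈ U` and non-integer `p`, `|b^w(π,v,p) − b^w(π',v,p)| ≤ 2·(max_{r≠s} w_{rs})·√(d(π,π'))`. -/
theorem bW_rank_change_bound {α : Type u} (U : Finset α) (w : α → α → ℝ)
    (hw : ∀ r ∈ U, ∀ s ∈ U, r ≠ s → 0 ≤ w r s)
    (π π' : α → ℝ) (hπ : IsRankingOn U π) (hπ' : IsRankingOn U π')
    (v : α) (hv : v ∈ U) (p : ℝ) (hp : ∀ m : ℤ, p ≠ (m : ℝ)) :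
    |bW U w π v p - bW U w π' v p| ≤
      2 * sSup {x : ℝ | ∃ r ∈ U, ∃ s ∈ U, r ≠ s ∧ x = w r s} *
        Real.sqrt (kendall U π π') := by
  set M := sSup {x : ℝ | ∃ r ∈ U, ∃ s ∈ U, r ≠ s ∧ x = w r s} with hM_def
  have hM : 0 ≤ M := by
    refine Real.sSup_nonneg ?_
    rintro x ⟨r, hr, s, hs, hrs, rfl⟩
    exact hw r hr s hs hrs
  have hbound := abs_bW_sub_bW_le hw hM
    (fun r hr s hs hrs => weight_le_sSup w hr hs hrs) hv
    (fun x hx => hπ.ne_of_forall_ne_int hp hx) (fun x hx => hπ'.ne_of_forall_ne_int hp hx)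
  have hkendall := card_crossing_mul_card_crossing_le_kendall U π π' p
  rw [← hπ.card_crossing_eq hπ' hp] at hbound hkendall
  have hsqrt : ((U.filter fun x => π x < p ∧ p < π' x).card : ℝ) ≤
      Real.sqrt (kendall U π π') := by
    refine Real.le_sqrt_of_sq_le ?_
    rw [sq]
    exact_mod_cast hkendall
  have := mul_le_mul_of_nonneg_left hsqrt hM
  linarith
end
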